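/- arXiv:1805.08424 — 2 statements merged into one kernel-verified Lean document; each statement's English description precedes it below -/
import Mathlib

section
/- For every δ > 0 there exist ε > 0 and n₀ ∈ ℕ such that the following holds for all n ≥ n₀ and all r ≥ ε⁻¹: if G is an n-vertex graph in which every vertex has degree (1±ε)r, and φ is an edge-colouring of G that is (1+ε)r-bounded and locally εr-bounded, then G has a 2δ-decomposition into δ-spanning rainbow matchings. -/
namespace Paper

variable {V : Type*} {W : Type*} {C : Type*}

/-- The set of edges of `G` receiving colour `c` under `φ`. -/
def colourCls (G : SimpleGraph V) (φ : Sym2 V → C) (c : C) : Set (Sym2 V) :=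
  {e | e ∈ G.edgeSet ∧ φ e = c}

/-- `φ` is a (globally) `g`-bounded edge-colouring of `G`:
every colour is used on at most `g` edges. -/
def GBounded (G : SimpleGraph V) (φ : Sym2 V → C) (g : ℝ) : Prop :=
  ∀ c : C, ((colourCls G φ c).ncard : ℝ) ≤ g

/-- `φ` is a locally `l`-bounded edge-colouring of `G`:
every vertex is incident to at most `l` edges of each colour. -/
def LBounded (G : SimpleGraph V) (φ : Sym2 V → C) (l : ℝ) : Prop :=
  ∀ (v : V) (c : C), (({u | G.Adj v u ∧ φ s(v, u) = c}).ncard : ℝ) ≤ l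

/-- A set of edges is rainbow if the colouring is injective on it. -/
def Rainbow (φ : Sym2 V → C) (E : Set (Sym2 V)) : Prop :=
  Set.InjOn φ E

/-- The set of common neighbours `w` of `u` and `v` with `φ(uw) = φ(vw)`. -/
def monoSet (G : SimpleGraph V) (φ : Sym2 V → C) (u v : V) : Set V :=
  {w | G.Adj u w ∧ G.Adj v w ∧ φ s(u, w) = φ s(v, w)}

/-- The monochromatic codegree `c^φ_G(u,v)`. -/
noncomputable def monoCodeg (G : SimpleGraph V) (φ : Sym2 V → C) (u v : V) : ℕ :=
  (monoSet G φ u v).ncard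

/-- Degree of `u` into the set `S`. -/
noncomputable def degIn (G : SimpleGraph V) (u : V) (S : Set V) : ℕ :=
  (G.neighborSet u ∩ S).ncard

/-- Codegree of `u,v` into the set `S`. -/
noncomputable def codegIn (G : SimpleGraph V) (u v : V) (S : Set V) : ℕ :=
  (G.neighborSet u ∩ G.neighborSet v ∩ S).ncard

/-- `G` restricted to `S` is `(ε,d)`-quasirandom: all degrees (within `S`)
are `(d ± ε)|S|` and all but at most `ε|S|²` unordered pairs of distinct
vertices of `S` have codegree (within `S`) equal to `(d² ± ε)|S|`. -/
def QuasirandomOn (G : SimpleGraph V) (S : Set V) (ε d : ℝ) : Prop :=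
  (∀ v ∈ S, |(degIn G v S : ℝ) - d * S.ncard| ≤ ε * S.ncard) ∧
  ((({p : Sym2 V | ∃ u v, p = s(u, v) ∧ u ≠ v ∧ u ∈ S ∧ v ∈ S ∧
        ¬ (|(codegIn G u v S : ℝ) - d ^ 2 * S.ncard| ≤ ε * S.ncard)}).ncard : ℝ)
      ≤ ε * (S.ncard : ℝ) ^ 2)

/-- `G` is `(ε,d)`-quasirandom. -/
def Quasirandom (G : SimpleGraph V) (ε d : ℝ) : Prop :=
  QuasirandomOn G Set.univ ε d

/-- Edges of `G` with one endpoint in `X` and the other in `Y`. -/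
def edgesBetween (G : SimpleGraph V) (X Y : Set V) : Set (Sym2 V) :=
  {e | e ∈ G.edgeSet ∧ ∃ u v, e = s(u, v) ∧ u ∈ X ∧ v ∈ Y}

/-- The pair `(A,B)` is `(ε,d)`-regular in `G`. -/
def RegularPair (G : SimpleGraph V) (A B : Set V) (ε d : ℝ) : Prop :=
  ∀ X ⊆ A, ∀ Y ⊆ B, ε * A.ncard ≤ (X.ncard : ℝ) → ε * B.ncard ≤ (Y.ncard : ℝ) →
    |((edgesBetween G X Y).ncard : ℝ) / ((X.ncard : ℝ) * (Y.ncard : ℝ)) - d| ≤ ε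

/-- The pair `(A,B)` is `(ε,d)`-superregular in `G`. -/
def SuperregularPair (G : SimpleGraph V) (A B : Set V) (ε d : ℝ) : Prop :=
  RegularPair G A B ε d ∧
  (∀ u ∈ A, |(degIn G u B : ℝ) - d * B.ncard| ≤ ε * B.ncard) ∧
  (∀ v ∈ B, |(degIn G v A : ℝ) - d * A.ncard| ≤ ε * A.ncard)

/-- `H` is a copy of `F`: a subgraph of `G` isomorphic to `F`. -/
def IsCopy (F : SimpleGraph W) {G : SimpleGraph V} (H : G.Subgraph) : Prop :=
  Nonempty (F ≃g H.coe)

/-- `L` is the union of the family `𝒞` of pairwise vertex-disjoint copies of `F`. -/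
def IsFactorFrom (F : SimpleGraph W) {G : SimpleGraph V} (L : G.Subgraph)
    (𝒞 : Set G.Subgraph) : Prop :=
  (∀ H ∈ 𝒞, IsCopy F H) ∧
  𝒞.Pairwise (fun H₁ H₂ => Disjoint H₁.verts H₂.verts) ∧
  L = sSup 𝒞

/-- `L` consists of vertex-disjoint copies of `F`. -/
def IsFFactorSub (F : SimpleGraph W) {G : SimpleGraph V} (L : G.Subgraph) : Prop :=
  ∃ 𝒞 : Set G.Subgraph, IsFactorFrom F L 𝒞

/-- An `ε`-decomposition: pairwise edge-disjoint subgraphs of `G` which together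
contain all but at most an `ε`-proportion of the edges of `G`. -/
def ApxDecomp (G : SimpleGraph V) (ε : ℝ) {t : ℕ} (L : Fin t → G.Subgraph) : Prop :=
  (Pairwise fun i j => Disjoint (L i).edgeSet (L j).edgeSet) ∧
  ((G.edgeSet \ ⋃ i, (L i).edgeSet).ncard : ℝ) ≤ ε * (G.edgeSet.ncard : ℝ)

/-- `a(F) ≤ a`, where `a(F) = max {Δ(F), a'(F), a''(F)}`. -/
def AParamLe (F : SimpleGraph W) (a : ℕ) : Prop :=
  (∀ v, (F.neighborSet v).ncard ≤ a) ∧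
  (∀ u v, F.Adj u v →
    (F.neighborSet u).ncard + (F.neighborSet v).ncard - 2 ≤ a) ∧
  (∀ u v w, F.Adj u v → F.Adj v w → u ≠ w →
    (F.neighborSet u).ncard + (F.neighborSet v).ncard + (F.neighborSet w).ncard - 4 ≤ a)

end Paper

open Paper

namespace RandomRemoval

open Finset

variable {X Ω : Type*} [DecidableEq X] [Fintype Ω]

/-- The surviving set after the event `ω`: if all of `N ω` is alive, then `K ω` is removed. -/
def step (K N : Ω → Finset X) (U : Finset X) (ω : Ω) : Finset X :=
  if N ω ⊆ U then U \ K ω else U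

/-- The transition operator of the lazy chain in which the event `ω` occurs with
probability `q ω`. -/
noncomputable def transition (K N : Ω → Finset X) (q : Ω → ℝ) :
    Module.End ℝ (Finset X → ℝ) where
  toFun g U := g U + ∑ ω, q ω * (g (step K N U ω) - g U)
  map_add' f g := by
    ext U
    simp only [Pi.add_apply]
    rw [add_add_add_comm, ← sum_add_distrib]
    congr 1
    exact sum_congr rfl fun ω _ => by ring
  map_smul' c f := by
    ext U
    simp only [Pi.smul_apply, smul_eq_mul, RingHom.id_apply, mul_add, mul_sum]
    congr 1
    exact sum_congr rfl fun ω _ => by ring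

/-- The indicator function of `S` being alive. -/
def aliveInd (S : Finset X) (U : Finset X) : ℝ := if S ⊆ U then 1 else 0

/-- The probability that all of `S` is alive after `i` steps, starting with everything alive. -/
noncomputable def survival [Fintype X] (K N : Ω → Finset X) (q : Ω → ℝ) (i : ℕ)
    (S : Finset X) : ℝ :=
  (transition K N q ^ i) (aliveInd S) univ

variable {K N : Ω → Finset X} {q : Ω → ℝ}

lemma transition_apply (g : Finset X → ℝ) (U : Finset X) :
    transition K N q g U = g U + ∑ ω, q ω * (g (step K N U ω) - g U) := rfl

lemma transition_aliveInd (S : Finset X) :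
    transition K N q (aliveInd S) =
      aliveInd S - ∑ ω, (if Disjoint (K ω) S then 0 else q ω) • aliveInd (S ∪ N ω) := by
  ext U
  rw [transition_apply, Pi.sub_apply, Finset.sum_apply, sub_eq_add_neg, ← sum_neg_distrib]
  congr 1
  refine sum_congr rfl fun ω _ => ?_
  simp only [Pi.smul_apply, smul_eq_mul, aliveInd, step, union_subset_iff]
  by_cases hN : N ω ⊆ U
  · by_cases hS : S ⊆ U
    · by_cases hK : Disjoint (K ω) S
      · simp [hN, hS, hK, subset_sdiff, hK.symm]
      · have : ¬ Disjoint S (K ω) := fun h => hK h.symm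
        simp [hN, hS, hK, subset_sdiff, this]
    · simp [hN, hS, subset_sdiff]
  · simp [hN]

lemma survival_zero [Fintype X] (S : Finset X) : survival K N q 0 S = 1 := by
  simp [survival, aliveInd]

lemma survival_succ [Fintype X] (i : ℕ) (S : Finset X) :
    survival K N q (i + 1) S = survival K N q i S -
      ∑ ω, (if Disjoint (K ω) S then 0 else q ω) * survival K N q i (S ∪ N ω) := by
  simp only [survival]
  rw [pow_succ, Module.End.mul_apply, transition_aliveInd, map_sub, map_sum]
  simp only [map_smul, Pi.sub_apply, Finset.sum_apply, Pi.smul_apply, smul_eq_mul]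

lemma transition_pow_mem_Icc (hq : ∀ ω, 0 ≤ q ω) (hq1 : ∑ ω, q ω ≤ 1) (i : ℕ)
    (g : Finset X → ℝ) (hg : ∀ U, g U ∈ Set.Icc (0 : ℝ) 1) (U : Finset X) :
    (transition K N q ^ i) g U ∈ Set.Icc (0 : ℝ) 1 := by
  induction i generalizing U with
  | zero => simpa using hg U
  | succ i ih =>
    rw [pow_succ', Module.End.mul_apply, transition_apply]
    set f := (transition K N q ^ i) g
    have e : f U + ∑ ω, q ω * (f (step K N U ω) - f U)
        = (1 - ∑ ω, q ω) * f U + ∑ ω, q ω * f (step K N U ω) := by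
      simp only [mul_sub, sum_sub_distrib, ← sum_mul]; ring
    rw [e]
    have h1 : 0 ≤ ∑ ω, q ω * f (step K N U ω) :=
      sum_nonneg fun ω _ => mul_nonneg (hq ω) (ih _).1
    have h2 : ∑ ω, q ω * f (step K N U ω) ≤ ∑ ω, q ω :=
      sum_le_sum fun ω _ => mul_le_of_le_one_right (hq ω) (ih _).2
    have h3 := (ih U).1
    have h4 := (ih U).2
    constructor <;> nlinarith

lemma survival_mem_Icc [Fintype X] (hq : ∀ ω, 0 ≤ q ω) (hq1 : ∑ ω, q ω ≤ 1) (i : ℕ)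
    (S : Finset X) : survival K N q i S ∈ Set.Icc (0 : ℝ) 1 :=
  transition_pow_mem_Icc hq hq1 i _ (fun U => by unfold aliveInd; split_ifs <;> simp) _

/-- Some trajectory does at least as well as the average, and keeps any invariant. -/
lemma exists_le_transition_pow (hq : ∀ ω, 0 ≤ q ω) (hq1 : ∑ ω, q ω ≤ 1)
    {I : Finset X → Prop} (hI : ∀ U ω, I U → I (step K N U ω)) (i : ℕ)
    (g : Finset X → ℝ) (U₀ : Finset X) (h₀ : I U₀) :
    ∃ U, I U ∧ g U ≤ (transition K N q ^ i) g U₀ := by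
  induction i generalizing U₀ with
  | zero => exact ⟨U₀, h₀, by simp⟩
  | succ i ih =>
    rw [pow_succ', Module.End.mul_apply, transition_apply]
    set f := (transition K N q ^ i) g
    obtain ⟨o, ho⟩ := Finite.exists_min
      (fun o : Option Ω => f (o.elim U₀ (step K N U₀)))
    have hIo : I (o.elim U₀ (step K N U₀)) := by
      cases o with
      | none => exact h₀
      | some ω => exact hI _ _ h₀
    obtain ⟨U, hU, hle⟩ := ih _ hIo
    refine ⟨U, hU, hle.trans ?_⟩
    set m := f (o.elim U₀ (step K N U₀))
    have h1 : m ≤ f U₀ := ho none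
    have h2 : ∑ ω, q ω * m ≤ ∑ ω, q ω * f (step K N U₀ ω) :=
      sum_le_sum fun ω _ => mul_le_mul_of_nonneg_left (ho (some ω)) (hq ω)
    simp only [mul_sub, sum_sub_distrib, ← sum_mul] at h2 ⊢
    nlinarith

end RandomRemoval

namespace RandomRemoval

open Finset

variable {X Ω : Type*} [DecidableEq X] [Fintype Ω]

/-- Every event needs four elements, every element is removed at rate `(1 ± κ) h`, and all
codegrees are at most `κ h`. -/
structure Balanced (K N : Ω → Finset X) (q : Ω → ℝ) (h κ : ℝ) : Prop where
  subset : ∀ ω, K ω ⊆ N ω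
  card_eq : ∀ ω, #(N ω) = 4
  nonneg : ∀ ω, 0 ≤ q ω
  sum_le_one : ∑ ω, q ω ≤ 1
  deg : ∀ v, |∑ ω, (if v ∈ K ω then q ω else 0) - h| ≤ κ * h
  codeg : ∀ v u, v ≠ u → ∑ ω, (if v ∈ K ω ∧ u ∈ N ω then q ω else 0) ≤ κ * h
  pos : 0 < h
  le : h ≤ κ
  le_one : κ ≤ 1

/-- The idealised survival probability of a single element: the Euler scheme for `dy = -y⁴ dx`. -/
noncomputable def ideal (h : ℝ) : ℕ → ℝ
  | 0 => 1
  | i + 1 => ideal h i - h * ideal h i ^ 4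

variable {K N : Ω → Finset X} {q : Ω → ℝ} {h κ : ℝ}

lemma ideal_mem_Icc (h0 : 0 ≤ h) (h1 : h ≤ 1) (i : ℕ) : ideal h i ∈ Set.Icc (0 : ℝ) 1 := by
  induction i with
  | zero => simp [ideal]
  | succ i ih =>
    obtain ⟨a, b⟩ := ih
    have h3 : ideal h i ^ 3 ≤ 1 := pow_le_one₀ a b
    have h4 : 0 ≤ ideal h i ^ 3 := pow_nonneg a 3
    have e : ideal h (i + 1) = ideal h i * (1 - h * ideal h i ^ 3) := by
      simp only [ideal]; ring
    have h5 : h * ideal h i ^ 3 ≤ 1 := mul_le_one₀ h1 h4 h3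
    have h6 : 0 ≤ h * ideal h i ^ 3 := mul_nonneg h0 h4
    rw [e]
    constructor
    · exact mul_nonneg a (by linarith)
    · exact mul_le_one₀ b (by linarith) (by linarith)

lemma ideal_le (h0 : 0 ≤ h) (h1 : h ≤ 1) {z : ℝ} (hz : 0 < z) {i : ℕ}
    (hi : 1 ≤ i * h * z ^ 4) : ideal h i ≤ z := by
  have key : ∀ i : ℕ, ideal h i ≤ z ∨ ideal h i ≤ 1 - i * h * z ^ 4 := by
    intro i
    induction i with
    | zero => right; simp [ideal]
    | succ i ih =>
      have hm := ideal_mem_Icc h0 h1 i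
      have hnn : 0 ≤ h * ideal h i ^ 4 := mul_nonneg h0 (pow_nonneg hm.1 4)
      by_cases hc : ideal h i ≤ z
      · left; simp only [ideal]; linarith
      · right
        have h2 := ih.resolve_left hc
        have h3 : z ^ 4 ≤ ideal h i ^ 4 := pow_le_pow_left₀ hz.le (not_le.1 hc).le 4
        have h4 := mul_le_mul_of_nonneg_left h3 h0
        simp only [ideal]
        push_cast
        nlinarith
  rcases key i with h2 | h2 <;> linarith

lemma abs_one_sub_pow_sub_le {x : ℝ} (h0 : 0 ≤ x) (h1 : x ≤ 1) (m : ℕ) :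
    |(1 - x) ^ m - (1 - m * x)| ≤ m ^ 2 * x ^ 2 := by
  rw [abs_le]
  constructor
  · have := one_add_mul_le_pow (a := -x) (by linarith) m
    rw [← sub_eq_add_neg] at this
    nlinarith [mul_nonneg (sq_nonneg (m : ℝ)) (sq_nonneg x)]
  · induction m with
    | zero => simp
    | succ m ih =>
      rw [pow_succ]
      have h2 := mul_le_mul_of_nonneg_right ih (sub_nonneg.2 h1)
      have h3 : 0 ≤ (m : ℝ) := m.cast_nonneg
      have h4 : 0 ≤ (m : ℝ) ^ 2 * x ^ 2 * x := by positivity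
      have h5 : 0 ≤ (m : ℝ) * x ^ 2 := by positivity
      push_cast
      nlinarith [sq_nonneg x]

lemma abs_ideal_succ_pow_sub_le (h0 : 0 ≤ h) (h1 : h ≤ 1) (i m : ℕ) :
    |ideal h (i + 1) ^ m - (ideal h i ^ m - m * h * ideal h i ^ (m + 3))| ≤ m ^ 2 * h ^ 2 := by
  obtain ⟨a, b⟩ := ideal_mem_Icc h0 h1 i
  set F := ideal h i
  have h3 : F ^ 3 ≤ 1 := pow_le_one₀ a b
  have h4 : 0 ≤ F ^ 3 := pow_nonneg a 3
  have e : ideal h (i + 1) ^ m - (F ^ m - m * h * F ^ (m + 3)) =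
      F ^ m * ((1 - h * F ^ 3) ^ m - (1 - m * (h * F ^ 3))) := by
    have : ideal h (i + 1) = F * (1 - h * F ^ 3) := by simp only [ideal, F]; ring
    rw [this, mul_pow]; ring
  rw [e, abs_mul, abs_of_nonneg (pow_nonneg a m)]
  have h5 := abs_one_sub_pow_sub_le (mul_nonneg h0 h4) (mul_le_one₀ h1 h4 h3) m
  refine (mul_le_of_le_one_left (abs_nonneg _) (pow_le_one₀ a b)).trans (h5.trans ?_)
  have h6 : h * F ^ 3 ≤ h := mul_le_of_le_one_right h0 h3
  gcongr

lemma card_union_of_sum_eq_zero {A S : Finset X} {v : X} (hv : v ∈ S) (hvA : v ∈ A)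
    (hA : #A = 4) (h0 : ∀ u ∈ S.erase v, u ∉ A) : #(S ∪ A) = #S + 3 := by
  have h1 : S ∩ A = {v} := by
    ext u
    simp only [mem_inter, mem_singleton]
    constructor
    · rintro ⟨hu, huA⟩
      by_contra hne
      exact h0 u (mem_erase.2 ⟨hne, hu⟩) huA
    · rintro rfl; exact ⟨hv, hvA⟩
  have := card_union_add_card_inter S A
  rw [h1, hA, card_singleton] at this
  omega

/-- The contribution of the events removing a fixed element of `S`. -/
lemma Balanced.abs_sum_mem_sub_le (H : Balanced K N q h κ) {p : Finset X → ℝ}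
    (hp : ∀ S, p S ∈ Set.Icc (0 : ℝ) 1) {F b : ℝ} (hF0 : 0 ≤ F) (hF1 : F ≤ 1) (hb : 0 ≤ b)
    (S : Finset X) (hbS : ∀ T : Finset X, #T = #S + 3 → |p T - F ^ (#S + 3)| ≤ b)
    {v : X} (hv : v ∈ S) :
    |∑ ω, (if v ∈ K ω then q ω * p (S ∪ N ω) else 0) - h * F ^ (#S + 3)| ≤
      2 * h * b + #S * (κ * h) := by
  set G := F ^ (#S + 3) with hG
  have hG0 : 0 ≤ G := pow_nonneg hF0 _
  have hG1 : G ≤ 1 := pow_le_one₀ hF0 hF1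
  have hdeg := H.deg v
  set d := ∑ ω, (if v ∈ K ω then q ω else 0) with hd
  have e : ∑ ω, (if v ∈ K ω then q ω * p (S ∪ N ω) else 0) - h * G =
      ∑ ω, (if v ∈ K ω then q ω else 0) * (p (S ∪ N ω) - G) + (d - h) * G := by
    simp only [mul_sub, sum_sub_distrib, ← sum_mul]
    rw [← hd]
    simp only [ite_mul, zero_mul]
    ring
  have hpt : ∀ ω, |(if v ∈ K ω then q ω else 0) * (p (S ∪ N ω) - G)| ≤
      (if v ∈ K ω then q ω else 0) * b +
        ∑ u ∈ S.erase v, (if v ∈ K ω ∧ u ∈ N ω then q ω else 0) := by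
    intro ω
    have hsum : 0 ≤ ∑ u ∈ S.erase v, (if v ∈ K ω ∧ u ∈ N ω then q ω else 0) :=
      sum_nonneg fun u _ => by split_ifs; exacts [H.nonneg ω, le_rfl]
    by_cases hK : v ∈ K ω
    · rw [if_pos hK, abs_mul, abs_of_nonneg (H.nonneg ω)]
      by_cases h0 : ∀ u ∈ S.erase v, u ∉ N ω
      · have := hbS _ (card_union_of_sum_eq_zero hv (H.subset ω hK) (H.card_eq ω) h0)
        have := mul_le_mul_of_nonneg_left this (H.nonneg ω)
        linarith
      · push Not at h0
        obtain ⟨u, hu, huN⟩ := h0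
        have h1 : q ω ≤ ∑ u ∈ S.erase v, (if v ∈ K ω ∧ u ∈ N ω then q ω else 0) := by
          have := single_le_sum
            (f := fun u => if v ∈ K ω ∧ u ∈ N ω then q ω else 0)
            (fun u _ => by split_ifs; exacts [H.nonneg ω, le_rfl]) hu
          simpa [hK, huN] using this
        have h2 : |p (S ∪ N ω) - G| ≤ 1 := by
          rw [abs_le]
          constructor <;> linarith [(hp (S ∪ N ω)).1, (hp (S ∪ N ω)).2]
        have h3 := mul_le_of_le_one_right (H.nonneg ω) h2
        have h4 := mul_nonneg (H.nonneg ω) hb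
        linarith
    · simp [hK]
  have hmain : |∑ ω, (if v ∈ K ω then q ω else 0) * (p (S ∪ N ω) - G)| ≤
      d * b + (#S - 1) * (κ * h) := by
    refine (abs_sum_le_sum_abs _ _).trans ((sum_le_sum fun ω _ => hpt ω).trans ?_)
    rw [sum_add_distrib, ← sum_mul, sum_comm]
    have h1 : ∑ u ∈ S.erase v, ∑ ω, (if v ∈ K ω ∧ u ∈ N ω then q ω else 0) ≤
        ∑ u ∈ S.erase v, κ * h :=
      sum_le_sum fun u hu => H.codeg v u (ne_of_mem_erase hu).symm
    rw [sum_const, nsmul_eq_mul, card_erase_of_mem hv,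
      Nat.cast_sub (card_pos.2 ⟨v, hv⟩), Nat.cast_one] at h1
    linarith
  have hd2 : d ≤ 2 * h := by
    have := (abs_le.1 hdeg).2
    nlinarith [H.le_one, H.pos]
  have hdG : |(d - h) * G| ≤ κ * h := by
    rw [abs_mul, abs_of_nonneg hG0]
    exact (mul_le_of_le_one_right (abs_nonneg _) hG1).trans hdeg
  rw [e]
  refine (abs_add_le _ _).trans ?_
  have := mul_le_mul_of_nonneg_right hd2 hb
  linarith

lemma Balanced.abs_sum_sub_le (H : Balanced K N q h κ) {p : Finset X → ℝ}
    (hp : ∀ S, p S ∈ Set.Icc (0 : ℝ) 1) {F b : ℝ} (hF0 : 0 ≤ F) (hF1 : F ≤ 1) (hb : 0 ≤ b)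
    (S : Finset X) (hbS : ∀ T : Finset X, #T = #S + 3 → |p T - F ^ (#S + 3)| ≤ b) :
    |∑ ω, (if Disjoint (K ω) S then 0 else q ω) * p (S ∪ N ω) - #S * h * F ^ (#S + 3)| ≤
      2 * #S * h * b + 2 * #S ^ 2 * (κ * h) := by
  set A := ∑ ω, (if Disjoint (K ω) S then 0 else q ω) * p (S ∪ N ω)
  set B := ∑ v ∈ S, ∑ ω, (if v ∈ K ω then q ω * p (S ∪ N ω) else 0) with hB
  have hκh : 0 ≤ κ * h := mul_nonneg (H.pos.le.trans H.le) H.pos.le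
  have h1 : |B - #S * h * F ^ (#S + 3)| ≤ 2 * #S * h * b + #S ^ 2 * (κ * h) := by
    have e : B - #S * h * F ^ (#S + 3) = ∑ v ∈ S,
        (∑ ω, (if v ∈ K ω then q ω * p (S ∪ N ω) else 0) - h * F ^ (#S + 3)) := by
      rw [sum_sub_distrib, sum_const, nsmul_eq_mul, mul_assoc]
    rw [e]
    refine (abs_sum_le_sum_abs _ _).trans
      ((sum_le_sum fun v hv => H.abs_sum_mem_sub_le hp hF0 hF1 hb S hbS hv).trans ?_)
    rw [sum_const, nsmul_eq_mul]
    exact le_of_eq (by ring)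
  have hpt : ∀ ω, |∑ v ∈ S, (if v ∈ K ω then q ω * p (S ∪ N ω) else 0) -
      (if Disjoint (K ω) S then 0 else q ω) * p (S ∪ N ω)| ≤
      ∑ v ∈ S, ∑ u ∈ S.erase v, (if v ∈ K ω ∧ u ∈ N ω then q ω else 0) := by
    intro ω
    have hnn : ∀ v ∈ S, 0 ≤ ∑ u ∈ S.erase v, (if v ∈ K ω ∧ u ∈ N ω then q ω else 0) :=
      fun v _ => sum_nonneg fun u _ => by split_ifs; exacts [H.nonneg ω, le_rfl]
    by_cases hD : Disjoint (K ω) S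
    · have : ∑ v ∈ S, (if v ∈ K ω then q ω * p (S ∪ N ω) else 0) = 0 :=
        sum_eq_zero fun v hv => if_neg fun hvK => (disjoint_left.1 hD) hvK hv
      rw [this, if_pos hD]
      simpa using sum_nonneg hnn
    · rw [if_neg hD]
      obtain ⟨v, hvK, hvS⟩ := not_disjoint_iff.1 hD
      have e : ∑ v ∈ S, (if v ∈ K ω then q ω * p (S ∪ N ω) else 0) -
          q ω * p (S ∪ N ω) = ∑ u ∈ S.erase v, (if u ∈ K ω then q ω * p (S ∪ N ω) else 0) := by
        rw [← add_sum_erase S _ hvS, if_pos hvK]; ring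
      rw [e]
      refine (abs_sum_le_sum_abs _ _).trans (le_trans ?_ (single_le_sum hnn hvS))
      refine sum_le_sum fun u _ => ?_
      by_cases hu : u ∈ K ω
      · rw [if_pos hu, if_pos ⟨hvK, H.subset ω hu⟩,
          abs_of_nonneg (mul_nonneg (H.nonneg ω) (hp _).1)]
        exact mul_le_of_le_one_right (H.nonneg ω) (hp _).2
      · rw [if_neg hu, abs_zero]
        split_ifs
        exacts [H.nonneg ω, le_rfl]
  have h2 : |B - A| ≤ #S ^ 2 * (κ * h) := by
    rw [hB, sum_comm, ← sum_sub_distrib]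
    refine (abs_sum_le_sum_abs _ _).trans ((sum_le_sum fun ω _ => hpt ω).trans ?_)
    rw [sum_comm]
    have : ∀ v ∈ S, ∑ ω, ∑ u ∈ S.erase v, (if v ∈ K ω ∧ u ∈ N ω then q ω else 0) ≤
        #S * (κ * h) := by
      intro v _
      rw [sum_comm]
      refine (sum_le_sum fun u hu => H.codeg v u (ne_of_mem_erase hu).symm).trans ?_
      rw [sum_const, nsmul_eq_mul]
      gcongr
      exact erase_subset v S
    refine (sum_le_sum this).trans ?_
    rw [sum_const, nsmul_eq_mul]
    exact le_of_eq (by ring)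
  rw [abs_le] at h1 h2 ⊢
  constructor <;> linarith

lemma cast_le_two_pow_pred {m : ℕ} (hm : 1 ≤ m) : (m : ℝ) ≤ 2 ^ (m - 1) := by
  have : m ≤ 2 ^ (m - 1) := by
    have := (m - 1).lt_two_pow_self
    omega
  exact_mod_cast this

/-- Bernoulli's inequality in the form used to propagate geometric error bounds. -/
lemma growth_bound {a h β κ : ℝ} (ha : 2 ≤ a) (ha' : a ≤ 4) (h0 : 0 ≤ h) (hκβ : κ ≤ β)
    (hβ : 0 ≤ β) (m : ℕ) :
    β * a ^ m + (2 * m * h * (β * a ^ (m + 3)) + 3 * m ^ 2 * (κ * h)) ≤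
      β * (a + 1024 * h) ^ m := by
  rcases Nat.eq_zero_or_pos m with rfl | hm
  · simp
  obtain ⟨k, rfl⟩ : ∃ k, m = k + 1 := ⟨m - 1, by omega⟩
  have hk := cast_le_two_pow_pred hm
  rw [Nat.add_sub_cancel] at hk
  set m : ℝ := ((k + 1 : ℕ) : ℝ)
  have hm0 : 0 ≤ m := Nat.cast_nonneg _
  have hB : a ^ (k + 1) + m * (1024 * h) * a ^ k ≤ (a + 1024 * h) ^ (k + 1) := by
    have hB := one_add_mul_le_pow (a := 1024 * h / a)
      (by have : 0 ≤ 1024 * h / a := by positivity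
          linarith) (k + 1)
    have ha0 : 0 < a := by linarith
    have := mul_le_mul_of_nonneg_left hB (pow_nonneg ha0.le (k + 1))
    rw [← mul_pow] at this
    have e1 : a * (1 + 1024 * h / a) = a + 1024 * h := by field_simp
    have e2 : a ^ (k + 1) * (1 + m * (1024 * h / a)) =
        a ^ (k + 1) + m * (1024 * h) * a ^ k := by
      rw [pow_succ]; field_simp
    rw [e1, e2] at this
    exact this
  have h1 : m ≤ a ^ k := hk.trans (pow_le_pow_left₀ (by norm_num) ha k)
  have h2 : a ^ (k + 1 + 3) ≤ 256 * a ^ k := by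
    have : a ^ 4 ≤ 4 ^ 4 := pow_le_pow_left₀ (by linarith) ha' 4
    have h3 : 0 ≤ a ^ k := by positivity
    calc a ^ (k + 1 + 3) = a ^ 4 * a ^ k := by ring
      _ ≤ 4 ^ 4 * a ^ k := by gcongr
      _ = 256 * a ^ k := by norm_num
  have hak : 0 ≤ a ^ k := by positivity
  have t1 : 2 * m * h * (β * a ^ (k + 1 + 3)) ≤ 2 * m * h * (β * (256 * a ^ k)) := by gcongr
  have t2 : 3 * m ^ 2 * (κ * h) ≤ 3 * m * h * (β * a ^ k) := by
    calc 3 * m ^ 2 * (κ * h) ≤ 3 * m ^ 2 * (β * h) := by gcongr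
      _ = 3 * m * h * (β * m) := by ring
      _ ≤ 3 * m * h * (β * a ^ k) := by gcongr
  have t3 := mul_le_mul_of_nonneg_left hB hβ
  have t4 : 0 ≤ m * h * (β * a ^ k) := by positivity
  nlinarith

variable [Fintype X]

lemma Balanced.survival_error_succ (H : Balanced K N q h κ) {β a : ℝ} (ha : 2 ≤ a)
    (ha' : a ≤ 4) (hκβ : κ ≤ β) (i : ℕ)
    (hi : ∀ S : Finset X, |survival K N q i S - ideal h i ^ #S| ≤ β * a ^ #S) (S : Finset X) :
    |survival K N q (i + 1) S - ideal h (i + 1) ^ #S| ≤ β * (a + 1024 * h) ^ #S := by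
  have hβ : 0 ≤ β := H.pos.le.trans (H.le.trans hκβ)
  have h1 : h ≤ 1 := H.le.trans H.le_one
  obtain ⟨hF0, hF1⟩ := ideal_mem_Icc H.pos.le h1 i
  have e1 := abs_ideal_succ_pow_sub_le H.pos.le h1 i #S
  have e2 := H.abs_sum_sub_le (survival_mem_Icc H.nonneg H.sum_le_one i) hF0 hF1
    (b := β * a ^ (#S + 3)) (by positivity) S (fun T hT => by rw [← hT]; exact hi T)
  have e3 := hi S
  have e4 := growth_bound ha ha' H.pos.le hκβ hβ #S
  have e5 : (#S : ℝ) ^ 2 * h ^ 2 ≤ #S ^ 2 * (κ * h) := by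
    have := mul_le_mul_of_nonneg_right H.le H.pos.le
    rw [← pow_two] at this
    gcongr
  rw [survival_succ]
  rw [abs_le] at e1 e2 e3 ⊢
  constructor <;> linarith

lemma Balanced.survival_error_of_le (H : Balanced K N q h κ) {β : ℝ} (hκβ : κ ≤ β) (i₀ : ℕ)
    (h₀ : ∀ S : Finset X, |survival K N q i₀ S - ideal h i₀ ^ #S| ≤ β * 2 ^ #S)
    (i : ℕ) (hi : 512 * (i * h) ≤ 1) (S : Finset X) :
    |survival K N q (i₀ + i) S - ideal h (i₀ + i) ^ #S| ≤ β * (2 + 1024 * (i * h)) ^ #S := by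
  induction i generalizing S with
  | zero => simpa using h₀ S
  | succ i ih =>
    push_cast at hi
    have hp := H.pos
    have h2 : 0 ≤ (i : ℝ) * h := by positivity
    have := H.survival_error_succ (β := β) (a := 2 + 1024 * (i * h)) (by linarith)
      (by linarith) hκβ (i₀ + i) (fun T => ih (by linarith) T) S
    rwa [show 2 + 1024 * ((i : ℝ) * h) + 1024 * h = 2 + 1024 * (((i + 1 : ℕ) : ℝ) * h) by
      push_cast; ring] at this

lemma Balanced.survival_error_sqrt (H : Balanced K N q h κ) {b : ℝ} (hb : 0 ≤ b)
    (hκ : κ ≤ b ^ 2) {s : ℕ} (hs : 512 * (s * h) ≤ 1) (i₀ : ℕ)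
    (h₀ : ∀ S : Finset X, |survival K N q i₀ S - ideal h i₀ ^ #S| ≤ b ^ 2 * 2 ^ #S)
    (S : Finset X) :
    |survival K N q (i₀ + s) S - ideal h (i₀ + s) ^ #S| ≤ b * 2 ^ #S := by
  have e := H.survival_error_of_le hκ i₀ h₀ s hs S
  have hF := ideal_mem_Icc H.pos.le (H.le.trans H.le_one) (i₀ + s)
  have hS := survival_mem_Icc (K := K) (N := N) H.nonneg H.sum_le_one (i₀ + s) S
  have hF0 : 0 ≤ ideal h (i₀ + s) ^ #S := pow_nonneg hF.1 _
  have hF1 : ideal h (i₀ + s) ^ #S ≤ 1 := pow_le_one₀ hF.1 hF.2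
  set x := survival K N q (i₀ + s) S - ideal h (i₀ + s) ^ #S
  have hx1 : |x| ≤ 1 := abs_le.2 ⟨by linarith [hS.1], by linarith [hS.2]⟩
  have hx2 : |x| ≤ (b * 2 ^ #S) ^ 2 := by
    refine e.trans ?_
    rw [mul_pow, ← pow_mul, mul_comm #S, pow_mul]
    have hp := H.pos
    gcongr
    linarith
  refine abs_le_of_sq_le_sq ?_ (by positivity)
  calc x ^ 2 = |x| * |x| := by rw [← sq_abs, pow_two]
    _ ≤ 1 * |x| := by gcongr
    _ ≤ _ := by rw [one_mul]; exact hx2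

/-- In a sufficiently balanced system every element is eventually removed with probability
close to one. -/
theorem exists_survival_le {ζ : ℝ} (hζ : 0 < ζ) :
    ∃ κ : ℝ, 0 < κ ∧ κ ≤ 1 ∧ ∃ J : ℕ, ∀ {X Ω : Type} [DecidableEq X] [Fintype X] [Fintype Ω]
      (K N : Ω → Finset X) (q : Ω → ℝ) (h : ℝ) (s : ℕ), 512 * (s * h) = 1 →
      Balanced K N q h κ → ∀ v, survival K N q (J * s) {v} ≤ ζ := by
  obtain ⟨J, hJ⟩ := exists_nat_ge (512 / (ζ / 2) ^ 4)
  set b := min (ζ / 4) 1 with hb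
  have hb0 : 0 < b := by positivity
  have hb1 : b ≤ 1 := min_le_right _ _
  refine ⟨b ^ 2 ^ J, by positivity, pow_le_one₀ hb0.le hb1, J, ?_⟩
  intro X Ω _ _ _ K N q h s hs H v
  have main : ∀ j ≤ J, ∀ S : Finset X,
      |survival K N q (j * s) S - ideal h (j * s) ^ #S| ≤ b ^ 2 ^ (J - j) * 2 ^ #S := by
    intro j
    induction j with
    | zero =>
      intro _ S
      simp only [zero_mul, survival_zero, ideal, one_pow, sub_self, abs_zero]
      positivity
    | succ j ih =>
      intro hj S
      have e : (b ^ 2 ^ (J - (j + 1))) ^ 2 = b ^ 2 ^ (J - j) := by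
        rw [← pow_mul, ← pow_succ, show J - (j + 1) + 1 = J - j by omega]
      rw [Nat.succ_mul]
      refine H.survival_error_sqrt (by positivity) ?_ hs.le _ ?_ S
      · rw [e]
        exact pow_le_pow_of_le_one hb0.le hb1 (Nat.pow_le_pow_right (by norm_num) (by omega))
      · rw [e]
        exact ih (by omega)
  have h1 := (abs_le.1 (main J le_rfl {v})).2
  have h2 : ideal h (J * s) ≤ ζ / 2 := by
    refine ideal_le H.pos.le (H.le.trans H.le_one) (by positivity) ?_
    have h3 : 512 ≤ J * (ζ / 2) ^ 4 := by rwa [div_le_iff₀ (by positivity)] at hJ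
    have h4 : (s : ℝ) * h = 1 / 512 := by linarith
    push_cast
    rw [mul_assoc (J : ℝ), h4]
    linarith
  have h3 : b ≤ ζ / 4 := min_le_left _ _
  simp only [card_singleton, pow_one, Nat.sub_self, pow_zero] at h1
  linarith

end RandomRemoval

namespace RandomRemoval

open Finset

variable {V E C : Type} [Fintype V] [Fintype E] [Fintype C] [DecidableEq V] [DecidableEq E]
  [DecidableEq C]

/-- A graph with edge set `E`, edge `e` having endpoints `ends e`, with an edge-colouring `φ`
which is nearly `r`-regular, nearly `r`-bounded and locally `ε r`-bounded. -/
structure NearlyRegular (ends : E → Finset V) (φ : E → C) (r ε : ℝ) : Prop where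
  card_ends : ∀ e, #(ends e) = 2
  deg : ∀ v, |(#{e | v ∈ ends e} : ℝ) - r| ≤ ε * r
  colour : ∀ c, (#{e | φ e = c} : ℝ) ≤ (1 + ε) * r
  locally_bounded : ∀ v c, (#{e | v ∈ ends e ∧ φ e = c} : ℝ) ≤ ε * r
  simple : ∀ u v, u ≠ v → #{e | u ∈ ends e ∧ v ∈ ends e} ≤ 1

/-- The elements which `t` disjoint rainbow matchings compete for: the vertices and the colours
in each of the matchings, and the edges. -/
abbrev Cell (V E C : Type) (t : ℕ) := (V × Fin t) ⊕ (E ⊕ (C × Fin t))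

/-- Either an edge is added to one of the `t` matchings, or (to compensate for rare colours) a
colour is forbidden in one of the matchings. -/
abbrev Event (E C : Type) (t : ℕ) := (E × Fin t) ⊕ ((C × Fin t) × (E × Fin t))

/-- The edge `e`, its endpoints in the `j`-th matching, and the colour `c` in the `i`-th one. -/
def block {t : ℕ} (ends : E → Finset V) (e : E) (j : Fin t) (c : C) (i : Fin t) :
    Finset (Cell V E C t) :=
  (ends e ×ˢ {j}).disjSum (disjSum {e} {(c, i)})

/-- The elements that must be alive for an event to have an effect. -/
def need {t : ℕ} (ends : E → Finset V) (φ : E → C) : Event E C t → Finset (Cell V E C t)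
  | .inl a => block ends a.1 a.2 (φ a.1) a.2
  | .inr b => block ends b.2.1 b.2.2 b.1.1 b.1.2

/-- The elements removed by an event. -/
def kill {t : ℕ} (ends : E → Finset V) (φ : E → C) : Event E C t → Finset (Cell V E C t)
  | .inl a => block ends a.1 a.2 (φ a.1) a.2
  | .inr b => {.inr (.inr b.1)}

/-- The deficit of a colour class, as a proportion of `r`. -/
noncomputable def deficit (φ : E → C) (r : ℝ) (c : C) : ℝ :=
  1 - min 1 ((#{e | φ e = c} : ℝ) / r)

/-- The probability of an event. -/
noncomputable def rate {t : ℕ} (φ : E → C) (r h : ℝ) : Event E C t → ℝ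
  | .inl _ => h / r
  | .inr b => h * deficit φ r b.1.1 / (Fintype.card E * t)

variable {ends : E → Finset V} {φ : E → C} {r ε h : ℝ} {t : ℕ}

omit [Fintype V] [Fintype E] [Fintype C] [DecidableEq V] [DecidableEq E] [DecidableEq C] in
lemma vertex_mem_block {e : E} {j i k : Fin t} {c : C} {x : V} :
    (.inl (x, k) : Cell V E C t) ∈ block ends e j c i ↔ x ∈ ends e ∧ k = j := by
  simp [block, eq_comm]

omit [Fintype V] [Fintype E] [Fintype C] [DecidableEq V] [DecidableEq E] [DecidableEq C] in
lemma edge_mem_block {e e' : E} {j i : Fin t} {c : C} :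
    (.inr (.inl e') : Cell V E C t) ∈ block ends e j c i ↔ e' = e := by
  simp [block]

omit [Fintype V] [Fintype E] [Fintype C] [DecidableEq V] [DecidableEq E] [DecidableEq C] in
lemma colour_mem_block {e : E} {j i k : Fin t} {c c' : C} :
    (.inr (.inr (c', k)) : Cell V E C t) ∈ block ends e j c i ↔ c' = c ∧ k = i := by
  simp [block]

omit [Fintype C] [DecidableEq E] in
lemma deficit_mem_Icc (hr : 0 ≤ r) (c : C) : deficit φ r c ∈ Set.Icc (0 : ℝ) 1 := by
  have : 0 ≤ min 1 ((#{e | φ e = c} : ℝ) / r) := by positivity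
  exact ⟨sub_nonneg.2 (min_le_left _ _), by unfold deficit; linarith⟩

omit [Fintype V] [Fintype C] in
lemma card_real_le (H : NearlyRegular ends φ r ε) (hr : 1 ≤ ε * r) (u v : Cell V E C t)
    (huv : u ≠ v) :
    (#{a : E × Fin t | u ∈ block ends a.1 a.2 (φ a.1) a.2 ∧
      v ∈ block ends a.1 a.2 (φ a.1) a.2} : ℝ) ≤ ε * r := by
  have one : ∀ s : Finset (E × Fin t), (∀ a ∈ s, ∀ b ∈ s, a = b) → (#s : ℝ) ≤ ε * r := by
    intro s hs
    refine le_trans ?_ hr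
    exact_mod_cast card_le_one.2 hs
  have loc : ∀ (s : Finset (E × Fin t)) (x : V) (c : C) (k : Fin t),
      (∀ a ∈ s, a.2 = k ∧ x ∈ ends a.1 ∧ φ a.1 = c) → (#s : ℝ) ≤ ε * r := by
    intro s x c k hs
    refine le_trans ?_ (H.locally_bounded x c)
    have : #s ≤ #{e | x ∈ ends e ∧ φ e = c} := by
      refine card_le_card_of_injOn Prod.fst (fun a ha => by simpa using (hs a ha).2) ?_
      intro a ha b hb hab
      exact Prod.ext hab ((hs a ha).1.trans (hs b hb).1.symm)
    exact_mod_cast this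
  rcases u with ⟨x, i⟩ | e | ⟨c, i⟩ <;> rcases v with ⟨y, j⟩ | e' | ⟨c', j⟩
  · refine one _ fun a ha b hb => ?_
    simp only [vertex_mem_block, mem_filter, mem_univ, true_and] at ha hb
    have hxy : x ≠ y := by
      rintro rfl
      exact huv (by rw [ha.1.2, ha.2.2])
    exact Prod.ext (card_le_one.1 (H.simple x y hxy) _ (by simp [ha.1.1, ha.2.1]) _
      (by simp [hb.1.1, hb.2.1])) (ha.1.2.symm.trans hb.1.2)
  · refine one _ fun a ha b hb => ?_
    simp only [vertex_mem_block, edge_mem_block, mem_filter, mem_univ, true_and] at ha hb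
    exact Prod.ext (ha.2.symm.trans hb.2) (ha.1.2.symm.trans hb.1.2)
  · refine loc _ x c' i fun a ha => ?_
    simp only [vertex_mem_block, colour_mem_block, mem_filter, mem_univ, true_and] at ha
    exact ⟨ha.1.2.symm, ha.1.1, ha.2.1.symm⟩
  · refine one _ fun a ha b hb => ?_
    simp only [vertex_mem_block, edge_mem_block, mem_filter, mem_univ, true_and] at ha hb
    exact Prod.ext (ha.1.symm.trans hb.1) (ha.2.2.symm.trans hb.2.2)
  · refine one _ fun a ha b hb => ?_
    simp only [edge_mem_block, mem_filter, mem_univ, true_and] at ha hb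
    exact absurd (by rw [ha.1, ha.2]) huv
  · refine one _ fun a ha b hb => ?_
    simp only [colour_mem_block, edge_mem_block, mem_filter, mem_univ, true_and] at ha hb
    exact Prod.ext (ha.1.symm.trans hb.1) (ha.2.2.symm.trans hb.2.2)
  · refine loc _ y c i fun a ha => ?_
    simp only [vertex_mem_block, colour_mem_block, mem_filter, mem_univ, true_and] at ha
    exact ⟨ha.1.2.symm, ha.2.1, ha.1.1.symm⟩
  · refine one _ fun a ha b hb => ?_
    simp only [colour_mem_block, edge_mem_block, mem_filter, mem_univ, true_and] at ha hb
    exact Prod.ext (ha.2.symm.trans hb.2) (ha.1.2.symm.trans hb.1.2)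
  · refine one _ fun a ha b hb => ?_
    simp only [colour_mem_block, mem_filter, mem_univ, true_and] at ha hb
    exact absurd (by rw [ha.1.1, ha.1.2, ha.2.1, ha.2.2]) huv

omit [Fintype V] [Fintype C] in
lemma card_dummy_le (ends : E → Finset V) (c : C) (i : Fin t) (u : Cell V E C t)
    (hu : u ≠ .inr (.inr (c, i))) :
    #{b : E × Fin t | u ∈ block ends b.1 b.2 c i} ≤ max (Fintype.card E) t := by
  rcases u with ⟨x, k⟩ | e | ⟨c', k⟩
  · refine le_trans ?_ (le_max_left _ _)
    refine card_le_card_of_injOn Prod.fst (fun _ _ => mem_coe.2 (mem_univ _)) ?_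
    intro a ha b hb hab
    simp only [vertex_mem_block, coe_filter, mem_univ, true_and, Set.mem_ofPred_eq] at ha hb
    exact Prod.ext hab (ha.2.symm.trans hb.2)
  · refine le_trans ?_ (le_max_right _ _)
    refine le_trans ?_ (card_fin t).le
    refine card_le_card_of_injOn Prod.snd (fun _ _ => mem_coe.2 (mem_univ _)) ?_
    intro a ha b hb hab
    simp only [edge_mem_block, coe_filter, mem_univ, true_and, Set.mem_ofPred_eq] at ha hb
    exact Prod.ext (ha.symm.trans hb) hab
  · have : ∀ b ∈ (univ : Finset (E × Fin t)),
        (.inr (.inr (c', k)) : Cell V E C t) ∉ block ends b.1 b.2 c i := by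
      intro b _ hb
      rw [colour_mem_block] at hb
      exact hu (by rw [hb.1, hb.2])
    rw [filter_false_of_mem this]
    simp

omit [Fintype C] [DecidableEq E] in
lemma two_mul_card_edges (H : NearlyRegular ends φ r ε) :
    ∑ v, (#{e | v ∈ ends e} : ℝ) = 2 * Fintype.card E := by
  have := sum_card_bipartiteAbove_eq_sum_card_bipartiteBelow
    (s := (univ : Finset V)) (t := (univ : Finset E)) (fun v e => v ∈ ends e)
  simp only [bipartiteAbove, bipartiteBelow, filter_univ_mem, H.card_ends, sum_const, card_univ,
    smul_eq_mul] at this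
  rw [mul_comm 2]
  exact_mod_cast this

omit [Fintype V] [Fintype C] [DecidableEq E] in
lemma half_le_card_edges [Nonempty V] (H : NearlyRegular ends φ r ε) (hr : 0 ≤ r)
    (hε : ε ≤ 1 / 2) : r / 2 ≤ Fintype.card E := by
  obtain ⟨v⟩ := ‹Nonempty V›
  have h1 := (abs_le.1 (H.deg v)).1
  have h2 : (#{e | v ∈ ends e} : ℝ) ≤ Fintype.card E := by exact_mod_cast card_le_univ _
  nlinarith

omit [DecidableEq E] in
lemma sum_rate_le (hr : 1 ≤ r) (hh : 0 ≤ h) (hE : 0 < Fintype.card E) (ht : 0 < t) :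
    ∑ ω : Event E C t, rate φ r h ω ≤ h * ((Fintype.card E + Fintype.card C) * t) := by
  have hE' : (0 : ℝ) < Fintype.card E := by exact_mod_cast hE
  have ht' : (0 : ℝ) < t := by exact_mod_cast ht
  rw [Fintype.sum_sum_type]
  have h1 : ∑ a : E × Fin t, rate φ r h (.inl a : Event E C t) ≤ ∑ a : E × Fin t, h :=
    sum_le_sum fun a _ => div_le_self hh hr
  have h2 : ∑ b : (C × Fin t) × (E × Fin t), rate φ r h (.inr b : Event E C t) ≤
      ∑ b : (C × Fin t) × (E × Fin t), h / (Fintype.card E * t) := by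
    refine sum_le_sum fun b _ => ?_
    have := mul_le_of_le_one_right hh (deficit_mem_Icc (φ := φ) (by linarith : 0 ≤ r) b.1.1).2
    simp only [rate]
    gcongr
  simp only [sum_const, card_univ, Fintype.card_prod, Fintype.card_fin, nsmul_eq_mul,
    Nat.cast_mul] at h1 h2
  refine (add_le_add h1 h2).trans (le_of_eq ?_)
  field_simp

omit [DecidableEq E] in
lemma sum_rate_filter (P : Event E C t → Prop) [DecidablePred P] :
    ∑ ω : Event E C t, (if P ω then rate φ r h ω else 0) =
      #{a : E × Fin t | P (.inl a)} * (h / r) +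
      ∑ c : C × Fin t, #{b : E × Fin t | P (.inr (c, b))} *
        (h * deficit φ r c.1 / (Fintype.card E * t)) := by
  rw [Fintype.sum_sum_type]
  congr 1
  · rw [← sum_filter]
    simp only [rate, sum_const, nsmul_eq_mul]
  · rw [Fintype.sum_prod_type]
    refine sum_congr rfl fun c _ => ?_
    rw [← sum_filter]
    simp only [rate, sum_const, nsmul_eq_mul]

omit [Fintype V] in
lemma sum_rate_kill (H : NearlyRegular ends φ r ε) (hr : 1 ≤ ε * r) (hr0 : 0 < r)
    (hh : 0 ≤ h) (hE : 0 < Fintype.card E) (ht : 0 < t) (htr : (t : ℝ) ≤ r)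
    (hrt : r ≤ t + 1) (v : Cell V E C t) :
    |∑ ω, (if v ∈ kill ends φ ω then rate φ r h ω else 0) - h| ≤ ε * h := by
  have hE' : (0 : ℝ) < Fintype.card E := by exact_mod_cast hE
  have ht' : (0 : ℝ) < t := by exact_mod_cast ht
  rw [sum_rate_filter]
  have bound : ∀ d : ℝ, |d - r| ≤ ε * r → |d * (h / r) - h| ≤ ε * h := by
    intro d hd
    have e : d * (h / r) - h = (d - r) * (h / r) := by field_simp
    rw [e, abs_mul, abs_of_nonneg (by positivity : 0 ≤ h / r)]
    calc |d - r| * (h / r) ≤ ε * r * (h / r) := by gcongr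
      _ = ε * h := by field_simp
  rcases v with ⟨x, k⟩ | e | ⟨c, k⟩
  · have e1 : #{a : E × Fin t | (.inl (x, k) : Cell V E C t) ∈ kill ends φ (.inl a)} =
        #{e | x ∈ ends e} := by
      refine card_bij (fun a _ => a.1) ?_ ?_ ?_
      · intro a ha
        simp only [kill, vertex_mem_block, mem_filter, mem_univ, true_and] at ha ⊢
        exact ha.1
      · intro a ha b hb hab
        simp only [kill, vertex_mem_block, mem_filter, mem_univ, true_and] at ha hb
        exact Prod.ext hab (ha.2.symm.trans hb.2)
      · intro e he
        simp only [mem_filter, mem_univ, true_and] at he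
        exact ⟨(e, k), by simp [kill, vertex_mem_block, he], rfl⟩
    rw [e1]
    simpa [kill] using bound _ (H.deg x)
  · have e1 : #{a : E × Fin t | (.inr (.inl e) : Cell V E C t) ∈ kill ends φ (.inl a)} = t := by
      refine Eq.trans ?_ (card_fin t)
      refine card_bij (fun a _ => a.2) (fun _ _ => mem_univ _) ?_ ?_
      · intro a ha b hb hab
        simp only [kill, edge_mem_block, mem_filter, mem_univ, true_and] at ha hb
        exact Prod.ext (ha.symm.trans hb) hab
      · intro k _
        exact ⟨(e, k), by simp [kill, edge_mem_block], rfl⟩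
    rw [e1]
    have := bound t (by rw [abs_le]; constructor <;> linarith)
    simpa [kill] using this
  · have e1 : #{a : E × Fin t | (.inr (.inr (c, k)) : Cell V E C t) ∈ kill ends φ (.inl a)} =
        #{e | φ e = c} := by
      refine card_bij (fun a _ => a.1) ?_ ?_ ?_
      · intro a ha
        simp only [kill, colour_mem_block, mem_filter, mem_univ, true_and] at ha ⊢
        exact ha.1.symm
      · intro a ha b hb hab
        simp only [kill, colour_mem_block, mem_filter, mem_univ, true_and] at ha hb
        exact Prod.ext hab (ha.2.symm.trans hb.2)
      · intro e he
        simp only [mem_filter, mem_univ, true_and] at he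
        exact ⟨(e, k), by simp [kill, colour_mem_block, he], rfl⟩
    have e2 : ∑ b : C × Fin t, (#{a : E × Fin t |
        (.inr (.inr (c, k)) : Cell V E C t) ∈ kill ends φ (.inr (b, a))} : ℝ) *
          (h * deficit φ r b.1 / (Fintype.card E * t)) = h * deficit φ r c := by
      rw [sum_eq_single (c, k)]
      · simp [kill]
        field_simp
      · intro b _ hb
        simp [kill, hb.symm]
      · simp
    rw [e1, e2]
    have hc := H.colour c
    set d : ℝ := (#{e | φ e = c} : ℝ) with hd
    have hdr : d / r ≤ 1 + ε := (div_le_iff₀ hr0).2 hc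
    have hε : 0 ≤ ε := by
      by_contra hneg
      nlinarith [not_le.1 hneg]
    have e3 : d * (h / r) + h * deficit φ r c - h = h * (d / r - min 1 (d / r)) := by
      simp only [deficit, ← hd]
      ring
    rw [e3, abs_mul, abs_of_nonneg hh, mul_comm ε]
    refine mul_le_mul_of_nonneg_left ?_ hh
    rw [abs_of_nonneg (sub_nonneg.2 (min_le_right _ _))]
    rcases min_choice 1 (d / r) with h4 | h4 <;> rw [h4] <;> linarith

omit [Fintype V] in
lemma sum_rate_need_le (H : NearlyRegular ends φ r ε) (hr : 1 ≤ ε * r) (hr0 : 0 < r)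
    (hh : 0 ≤ h) (hE : r / 2 ≤ Fintype.card E) (ht : r / 2 ≤ t) (v u : Cell V E C t)
    (hvu : v ≠ u) :
    ∑ ω, (if v ∈ kill ends φ ω ∧ u ∈ need ends φ ω then rate φ r h ω else 0) ≤
      3 * ε * h := by
  have hE' : (0 : ℝ) < Fintype.card E := by linarith
  have ht' : (0 : ℝ) < t := by linarith
  have hε : 0 < ε := by
    by_contra hneg
    nlinarith [not_lt.1 hneg]
  rw [sum_rate_filter]
  have h1 : (#{a : E × Fin t | v ∈ kill ends φ (.inl a) ∧ u ∈ need ends φ (.inl a)} : ℝ) *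
      (h / r) ≤ ε * h := by
    calc _ ≤ ε * r * (h / r) :=
          mul_le_mul_of_nonneg_right (card_real_le H hr v u hvu) (by positivity)
      _ = ε * h := by field_simp
  have h2 : ∑ c : C × Fin t, (#{b : E × Fin t | v ∈ kill ends φ (.inr (c, b)) ∧
      u ∈ need ends φ (.inr (c, b))} : ℝ) * (h * deficit φ r c.1 / (Fintype.card E * t)) ≤
      2 * ε * h := by
    rcases v with x | e | c
    · simp only [kill, mem_singleton, reduceCtorEq, false_and, filter_false, card_empty,
        Nat.cast_zero, zero_mul, sum_const_zero]
      positivity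
    · simp only [kill, mem_singleton, Sum.inr.injEq, reduceCtorEq, false_and, filter_false,
        card_empty, Nat.cast_zero, zero_mul, sum_const_zero]
      positivity
    · rw [sum_eq_single c]
      · have h3 : #{b : E × Fin t | (.inr (.inr c) : Cell V E C t) ∈ kill ends φ (.inr (c, b)) ∧
            u ∈ need ends φ (.inr (c, b))} ≤ max (Fintype.card E) t := by
          refine le_trans (card_le_card ?_) (card_dummy_le ends c.1 c.2 u hvu.symm)
          intro b hb
          simp only [mem_filter, mem_univ, true_and] at hb ⊢
          exact hb.2
        have h4 : ((max (Fintype.card E) t : ℕ) : ℝ) ≤ 2 * ε * (Fintype.card E * t) := by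
          have h7 : 1 ≤ 2 * ε * t := by nlinarith
          have h8 : 1 ≤ 2 * ε * Fintype.card E := by nlinarith
          rw [Nat.cast_max]
          refine max_le ?_ ?_ <;> nlinarith
        have h5 := mul_le_of_le_one_right hh (deficit_mem_Icc (φ := φ) hr0.le c.1).2
        have h6 := mul_nonneg hh (deficit_mem_Icc (φ := φ) hr0.le c.1).1
        calc _ ≤ 2 * ε * (Fintype.card E * t) *
              (h * deficit φ r c.1 / (Fintype.card E * t)) :=
              mul_le_mul_of_nonneg_right (le_trans (by exact_mod_cast h3) h4) (by positivity)
          _ = 2 * ε * (h * deficit φ r c.1) := by field_simp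
          _ ≤ 2 * ε * h := by gcongr
      · intro b _ hb
        simp [kill, hb.symm]
      · simp
  linarith

omit [Fintype V] in
lemma balanced (H : NearlyRegular ends φ r ε) {κ : ℝ} (hr : 1 ≤ ε * r) (hr0 : 0 < r)
    (hE : r / 2 ≤ Fintype.card E) (ht : r / 2 ≤ t) (htr : (t : ℝ) ≤ r)
    (hrt : r ≤ t + 1) (hr1 : 1 ≤ r) (hκ : 3 * ε ≤ κ) (hκ1 : κ ≤ 1) (hh : 0 < h) (hhκ : h ≤ κ)
    (hsum : h * ((Fintype.card E + Fintype.card C) * t) ≤ 1) :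
    Balanced (kill ends φ) (need ends φ) (rate φ r h : Event E C t → ℝ) h κ where
  subset ω := by
    rcases ω with a | ⟨⟨c, i⟩, e, j⟩
    · exact Subset.rfl
    · intro x hx
      rw [kill, mem_singleton] at hx
      rw [hx, need, colour_mem_block]
      exact ⟨rfl, rfl⟩
  card_eq ω := by
    rcases ω with a | a <;> simp [need, block, H.card_ends]
  nonneg ω := by
    rcases ω with a | b
    · simp only [rate]; positivity
    · have := (deficit_mem_Icc (φ := φ) hr0.le b.1.1).1
      simp only [rate]; positivity
  sum_le_one := by
    refine (sum_rate_le hr1 hh.le ?_ ?_).trans hsum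
    · have : (0 : ℝ) < Fintype.card E := by linarith
      exact_mod_cast this
    · have : (0 : ℝ) < t := by linarith
      exact_mod_cast this
  deg v := by
    have hE0 : (0 : ℝ) < Fintype.card E := by linarith
    have ht0 : (0 : ℝ) < t := by linarith
    refine (sum_rate_kill H hr hr0 hh.le (by exact_mod_cast hE0) (by exact_mod_cast ht0)
      htr hrt v).trans ?_
    have : ε ≤ κ := by nlinarith
    gcongr
  codeg v u hvu := by
    refine (sum_rate_need_le H hr hr0 hh.le hE ht v u hvu).trans ?_
    gcongr
  pos := hh
  le := hhκ
  le_one := hκ1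

end RandomRemoval

namespace RandomRemoval

open Finset

variable {V E C : Type} [Fintype V] [Fintype E] [Fintype C] [DecidableEq V] [DecidableEq E]
  [DecidableEq C]

/-- The dead vertices are covered by disjoint blocks which are entirely dead. -/
def IsTrace {t : ℕ} (ends : E → Finset V) (φ : E → C) (U : Finset (Cell V E C t)) : Prop :=
  ∃ M : Finset (E × Fin t),
    (∀ a ∈ M, ∀ b ∈ M, a ≠ b →
      Disjoint (block ends a.1 a.2 (φ a.1) a.2) (block ends b.1 b.2 (φ b.1) b.2)) ∧
    (∀ a ∈ M, Disjoint (block ends a.1 a.2 (φ a.1) a.2) U) ∧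
    ∀ x : V × Fin t, .inl x ∉ U → ∃ a ∈ M, .inl x ∈ block ends a.1 a.2 (φ a.1) a.2

omit [Fintype V] [Fintype E] [Fintype C] in
lemma IsTrace.step {t : ℕ} {ends : E → Finset V} {φ : E → C} {U : Finset (Cell V E C t)}
    (hU : IsTrace ends φ U) (ω : Event E C t) :
    IsTrace ends φ (step (kill ends φ) (need ends φ) U ω) := by
  unfold RandomRemoval.step
  split_ifs with hN
  swap
  · exact hU
  obtain ⟨M, h1, h2, h3⟩ := hU
  rcases ω with e | b
  · refine ⟨insert e M, ?_, ?_, ?_⟩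
    · intro a ha b hb hab
      rcases mem_insert.1 ha with hae | haM <;> rcases mem_insert.1 hb with hbe | hbM
      · exact absurd (hae.trans hbe.symm) hab
      · subst hae
        exact ((h2 b hbM).mono_right hN).symm
      · subst hbe
        exact (h2 a haM).mono_right hN
      · exact h1 a haM b hbM hab
    · intro a ha
      rcases mem_insert.1 ha with rfl | ha
      · exact disjoint_sdiff
      · exact (h2 a ha).mono_right sdiff_subset
    · intro x hx
      by_cases hxe : .inl x ∈ block ends e.1 e.2 (φ e.1) e.2
      · exact ⟨e, mem_insert_self _ _, hxe⟩
      · obtain ⟨a, ha, hax⟩ := h3 x fun hxU => hx (mem_sdiff.2 ⟨hxU, hxe⟩)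
        exact ⟨a, mem_insert_of_mem ha, hax⟩
  · refine ⟨M, h1, fun a ha => (h2 a ha).mono_right sdiff_subset, fun x hx => h3 x ?_⟩
    exact fun hxU => hx (mem_sdiff.2 ⟨hxU, by simp [kill]⟩)

/-- A nearly regular graph with a suitably bounded colouring has `⌊r⌋` disjoint rainbow matchings
which on average are almost spanning. -/
theorem exists_disjoint_blocks {ζ : ℝ} (hζ : 0 < ζ) :
    ∃ ε₁ : ℝ, 0 < ε₁ ∧ ∀ {V E C : Type} [Fintype V] [Fintype E] [Fintype C] [DecidableEq V]
      [DecidableEq E] [DecidableEq C] [Nonempty V] (ends : E → Finset V) (φ : E → C) (r ε : ℝ)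
      (t : ℕ), ε ≤ ε₁ → 1 ≤ ε * r → 0 < r → t = ⌊r⌋₊ → NearlyRegular ends φ r ε →
      ∃ M : Finset (E × Fin t),
        (∀ a ∈ M, ∀ b ∈ M, a ≠ b →
          Disjoint (block ends a.1 a.2 (φ a.1) a.2) (block ends b.1 b.2 (φ b.1) b.2)) ∧
        (#{x : V × Fin t | ∀ a ∈ M, ¬ (x.1 ∈ ends a.1 ∧ x.2 = a.2)} : ℝ) ≤
          ζ * (Fintype.card V * t) := by
  obtain ⟨κ, hκ0, hκ1, J, hJ⟩ := exists_survival_le hζ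
  refine ⟨κ / 3, by positivity, ?_⟩
  intro V E C _ _ _ _ _ _ _ ends φ r ε t hε hr hr0 ht H
  have htr : (t : ℝ) ≤ r := ht ▸ Nat.floor_le hr0.le
  have hrt : r ≤ t + 1 := ht ▸ (Nat.lt_floor_add_one r).le
  have hr3 : 3 ≤ r := by nlinarith
  have hE := half_le_card_edges H hr0.le (by linarith)
  obtain ⟨s, hs⟩ := exists_nat_ge
    (max (1 / κ) ((Fintype.card E + Fintype.card C) * t))
  have hs1 := (le_max_left _ _).trans hs
  have hs2 := (le_max_right _ _).trans hs
  have hs0 : (0 : ℝ) < s := lt_of_lt_of_le (by positivity) hs1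
  set h : ℝ := 1 / (512 * s) with hh
  have hh0 : 0 < h := by positivity
  have hsh : 512 * ((s : ℝ) * h) = 1 := by rw [hh]; field_simp
  have hhκ : h ≤ κ := by
    rw [div_le_iff₀ hκ0] at hs1
    rw [hh, div_le_iff₀ (by positivity)]
    nlinarith
  have hB : Balanced (kill ends φ) (need ends φ) (rate φ r h : Event E C t → ℝ) h κ := by
    refine balanced H hr hr0 hE (by linarith) htr hrt (by linarith) (by linarith) hκ1 hh0 hhκ ?_
    refine (mul_le_mul_of_nonneg_left hs2 hh0.le).trans ?_
    linarith
  have hsurv := hJ (kill ends φ) (need ends φ) (rate φ r h : Event E C t → ℝ) h s hsh hB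
  have h0 : IsTrace ends φ (univ : Finset (Cell V E C t)) :=
    ⟨∅, by simp, by simp, fun x hx => absurd (mem_univ _) hx⟩
  obtain ⟨U, ⟨M, hM1, hM2, hM3⟩, hle⟩ := exists_le_transition_pow hB.nonneg hB.sum_le_one
    (I := IsTrace ends φ) (fun U ω hU => hU.step ω) (J * s)
    (∑ x : V × Fin t, aliveInd {.inl x}) univ h0
  refine ⟨M, hM1, ?_⟩
  rw [map_sum, Finset.sum_apply, Finset.sum_apply] at hle
  have h1 : ∑ x : V × Fin t, aliveInd {(.inl x : Cell V E C t)} U =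
      #{x : V × Fin t | (.inl x : Cell V E C t) ∈ U} := by
    simp [aliveInd, sum_boole]
  have h2 : (#{x : V × Fin t | ∀ a ∈ M, ¬ (x.1 ∈ ends a.1 ∧ x.2 = a.2)} : ℝ) ≤
      #{x : V × Fin t | (.inl x : Cell V E C t) ∈ U} := by
    have := card_le_card (s := {x : V × Fin t | ∀ a ∈ M, ¬ (x.1 ∈ ends a.1 ∧ x.2 = a.2)})
      (t := {x : V × Fin t | (.inl x : Cell V E C t) ∈ U}) (by
        intro x hx
        simp only [mem_filter, mem_univ, true_and] at hx ⊢
        by_contra hxU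
        obtain ⟨a, ha, hax⟩ := hM3 x hxU
        exact hx a ha (vertex_mem_block.1 hax))
    exact_mod_cast this
  rw [← h1] at h2
  refine h2.trans (hle.trans ((sum_le_sum fun x _ => hsurv (.inl x)).trans ?_))
  rw [sum_const, nsmul_eq_mul, card_univ, Fintype.card_prod, Fintype.card_fin, Nat.cast_mul,
    mul_comm]

/-- Discarding the matchings which are not almost spanning. -/
theorem exists_good_blocks {δ : ℝ} (hδ : 0 < δ) :
    ∃ ε : ℝ, 0 < ε ∧ ∀ {V E C : Type} [Fintype V] [Fintype E] [Fintype C] [DecidableEq V]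
      [DecidableEq E] [DecidableEq C] [Nonempty V] (ends : E → Finset V) (φ : E → C) (r : ℝ),
      1 ≤ ε * r → NearlyRegular ends φ r ε →
      ∃ (t : ℕ) (M : Finset (E × Fin t)) (I : Finset (Fin t)),
        (∀ a ∈ M, ∀ b ∈ M, a ≠ b →
          Disjoint (block ends a.1 a.2 (φ a.1) a.2) (block ends b.1 b.2 (φ b.1) b.2)) ∧
        (∀ i ∈ I, (#{v : V | ∀ a ∈ M, ¬ (v ∈ ends a.1 ∧ i = a.2)} : ℝ) ≤
          δ * Fintype.card V) ∧
        (Fintype.card E : ℝ) - #{a ∈ M | a.2 ∈ I} ≤ 2 * δ * Fintype.card E := by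
  set ζ := δ / 4 / (1 / δ + 1) with hζ
  have hζ0 : 0 < ζ := by positivity
  obtain ⟨ε₁, hε₁, hmain⟩ := exists_disjoint_blocks hζ0
  refine ⟨min ε₁ (min (δ / 4) (1 / 2)), by positivity, ?_⟩
  intro V E C _ _ _ _ _ _ _ ends φ r hr H
  set ε := min ε₁ (min (δ / 4) (1 / 2))
  have hε1 : ε ≤ ε₁ := min_le_left _ _
  have hεδ : ε ≤ δ / 4 := (min_le_right _ _).trans (min_le_left _ _)
  have hε2 : ε ≤ 1 / 2 := (min_le_right _ _).trans (min_le_right _ _)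
  have hε0 : 0 < ε := by positivity
  have hr0 : 0 < r := by
    by_contra hneg
    nlinarith [not_lt.1 hneg]
  obtain ⟨t, ht⟩ : ∃ t, t = ⌊r⌋₊ := ⟨_, rfl⟩
  have htr : (t : ℝ) ≤ r := ht ▸ Nat.floor_le hr0.le
  have hrt : r ≤ t + 1 := ht ▸ (Nat.lt_floor_add_one r).le
  obtain ⟨M, hM, hcard⟩ := hmain ends φ r ε t hε1 hr hr0 ht H
  set n : ℝ := (Fintype.card V : ℝ) with hn
  have hn0 : 0 < n := by
    have := Fintype.card_pos (α := V)
    rw [hn]; exact_mod_cast this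
  set u : Fin t → ℝ := fun i => #{v : V | ∀ a ∈ M, ¬ (v ∈ ends a.1 ∧ i = a.2)} with hu
  have hu0 : ∀ i, 0 ≤ u i := fun i => Nat.cast_nonneg _
  have husum : ∑ i, u i ≤ ζ * (n * t) := by
    refine le_trans (le_of_eq ?_) hcard
    have h1 : #{x : V × Fin t | ∀ a ∈ M, ¬ (x.1 ∈ ends a.1 ∧ x.2 = a.2)} =
        ∑ i : Fin t, #{v : V | ∀ a ∈ M, ¬ (v ∈ ends a.1 ∧ i = a.2)} := by
      simp only [card_filter, Fintype.sum_prod_type_right]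
    rw [h1, Nat.cast_sum]
  set I : Finset (Fin t) := {i | u i ≤ δ * n} with hI
  refine ⟨t, M, I, hM, fun i hi => (mem_filter.1 hi).2, ?_⟩
  have hbad : (#(univ \ I) : ℝ) * (δ * n) ≤ ζ * (n * t) := by
    refine le_trans ?_ husum
    rw [← nsmul_eq_mul, ← sum_const]
    refine (sum_le_sum fun i hi => ?_).trans
      (sum_le_sum_of_subset_of_nonneg (subset_univ (univ \ I)) fun i _ _ => hu0 i)
    simp only [hI, mem_sdiff, mem_univ, mem_filter, true_and, not_le] at hi
    exact hi.le
  have hIcard : (#I : ℝ) + #(univ \ I) = t := by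
    have := card_sdiff_add_card_eq_card (subset_univ I)
    rw [card_univ, Fintype.card_fin] at this
    rw [add_comm]
    exact_mod_cast this
  have hcover : ∀ i : Fin t, n - u i ≤ 2 * #{a ∈ M | a.2 = i} := by
    intro i
    have h1 : (univ : Finset V) ⊆ (univ.filter fun v => ∀ a ∈ M, ¬ (v ∈ ends a.1 ∧ i = a.2)) ∪
        (M.filter fun a => a.2 = i).biUnion fun a => ends a.1 := by
      intro v _
      by_cases hv : ∀ a ∈ M, ¬ (v ∈ ends a.1 ∧ i = a.2)
      · exact mem_union_left _ (by simpa using hv)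
      · push Not at hv
        obtain ⟨a, ha, hva, hia⟩ := hv
        exact mem_union_right _ (mem_biUnion.2 ⟨a, mem_filter.2 ⟨ha, hia.symm⟩, hva⟩)
    have h2 := (card_le_card h1).trans (card_union_le _ _)
    have h3 : #((M.filter fun a => a.2 = i).biUnion fun a => ends a.1) ≤ #{a ∈ M | a.2 = i} * 2 :=
      card_biUnion_le_card_mul _ _ _ fun a _ => (H.card_ends a.1).le
    have h4 : Fintype.card V ≤ #{v : V | ∀ a ∈ M, ¬ (v ∈ ends a.1 ∧ i = a.2)} +
      #{a ∈ M | a.2 = i} * 2 := by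
      rw [card_univ] at h2
      omega
    have h5 : n ≤ u i + #{a ∈ M | a.2 = i} * 2 := by
      simp only [hn, hu]
      exact_mod_cast h4
    linarith
  have hMI : (#{a ∈ M | a.2 ∈ I} : ℝ) = ∑ i ∈ I, (#{a ∈ M | a.2 = i} : ℝ) := by
    have := card_eq_sum_card_fiberwise (s := {a ∈ M | a.2 ∈ I}) (t := I) (f := Prod.snd)
      (fun a ha => (mem_filter.1 (mem_coe.1 ha)).2)
    rw [this, Nat.cast_sum]
    refine sum_congr rfl fun i hi => ?_
    rw [filter_filter]
    congr 2
    ext a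
    simp only [mem_filter, and_congr_right_iff, and_iff_right_iff_imp]
    rintro _ rfl
    exact hi
  have hlower : #I * n - ζ * (n * t) ≤ 2 * #{a ∈ M | a.2 ∈ I} := by
    rw [hMI, mul_sum]
    refine le_trans ?_ (sum_le_sum fun i _ => hcover i)
    rw [sum_sub_distrib, sum_const, nsmul_eq_mul]
    have : ∑ i ∈ I, u i ≤ ∑ i, u i :=
      sum_le_sum_of_subset_of_nonneg (subset_univ I) fun i _ _ => hu0 i
    linarith
  have hdeg := two_mul_card_edges H
  have hup : 2 * (Fintype.card E : ℝ) ≤ n * ((1 + ε) * r) := by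
    rw [← hdeg, hn, ← card_univ, ← nsmul_eq_mul]
    exact sum_le_card_nsmul _ _ _ fun v _ => by linarith [(abs_le.1 (H.deg v)).2]
  have hlo : n * ((1 - ε) * r) ≤ 2 * (Fintype.card E : ℝ) := by
    rw [← hdeg, hn, ← card_univ, ← nsmul_eq_mul]
    exact card_nsmul_le_sum _ _ _ fun v _ => by linarith [(abs_le.1 (H.deg v)).1]
  have hbad' : (#(univ \ I) : ℝ) * n ≤ ζ * (1 / δ) * (n * t) := by
    have : (#(univ \ I) : ℝ) * n = (#(univ \ I) : ℝ) * (δ * n) / δ := by field_simp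
    rw [this, div_le_iff₀ hδ]
    refine hbad.trans (le_of_eq ?_)
    field_simp
  have hζδ : ζ * (1 / δ) + ζ = δ / 4 := by
    rw [hζ]; field_simp
  have e1 : #I * n = t * n - #(univ \ I) * n := by rw [← hIcard]; ring
  have e2 : ζ * (1 / δ) * (n * t) + ζ * (n * t) = δ / 4 * (n * t) := by rw [← hζδ]; ring
  have e3 : δ / 4 * (n * t) ≤ δ / 4 * (n * r) := by gcongr
  have e4 : n * r ≤ t * n + n := by nlinarith
  have e5 : n ≤ n * (ε * r) := le_mul_of_one_le_right hn0.le hr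
  have e6 : n * (ε * r) ≤ n * (δ / 4 * r) := by gcongr
  have e7 : n * (1 / 2 * r) ≤ n * ((1 - ε) * r) := by
    gcongr
    linarith
  have e8 : δ * (n * (1 / 2 * r)) ≤ δ * (2 * (Fintype.card E : ℝ)) :=
    mul_le_mul_of_nonneg_left (e7.trans hlo) hδ.le
  nlinarith

end RandomRemoval

namespace RandomRemoval

open Finset

section Subgraph

variable {V : Type*} {G : SimpleGraph V}

/-- The subgraph formed by a set of edges and their ends. -/
def ofEdges (S : Set (Sym2 V)) (hS : S ⊆ G.edgeSet) : G.Subgraph where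
  verts := {v | ∃ e ∈ S, v ∈ e}
  Adj u v := s(u, v) ∈ S
  adj_sub h := hS h
  edge_vert {u v} h := ⟨s(u, v), h, Sym2.mem_mk_left u v⟩
  symm := ⟨fun u v h => by rwa [Sym2.eq_swap]⟩

lemma edgeSet_ofEdges (S : Set (Sym2 V)) (hS : S ⊆ G.edgeSet) : (ofEdges S hS).edgeSet = S := by
  ext e
  induction e with
  | _ u v => rfl

lemma isMatching_ofEdges {S : Set (Sym2 V)} {hS : S ⊆ G.edgeSet}
    (h : ∀ e ∈ S, ∀ f ∈ S, ∀ v, v ∈ e → v ∈ f → e = f) : (ofEdges S hS).IsMatching := by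
  rintro v ⟨e, he, hve⟩
  obtain ⟨w, rfl⟩ := hve
  refine ⟨w, he, fun u hu => ?_⟩
  have := h _ hu _ he v (Sym2.mem_mk_left v u) (Sym2.mem_mk_left v w)
  exact Sym2.congr_right.1 this

end Subgraph

section Instantiate

variable {V : Type} [Fintype V] [DecidableEq V] {G : SimpleGraph V} [DecidableRel G.Adj]

/-- The ends of an edge. -/
def edgeEnds (G : SimpleGraph V) (e : G.edgeSet) : Finset V := e.1.toFinset

omit [Fintype V] [DecidableRel G.Adj] in
lemma mem_edgeEnds {e : G.edgeSet} {v : V} : v ∈ edgeEnds G e ↔ v ∈ e.1 := Sym2.mem_toFinset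

/-- The colour of an edge, as an element of the finite set of all colours used. -/
def edgeColour (G : SimpleGraph V) (φ : Sym2 V → ℕ) (e : G.edgeSet) :
    (univ.image φ : Finset ℕ) := ⟨φ e.1, mem_image_of_mem _ (mem_univ _)⟩

lemma card_incident (v : V) (P : Sym2 V → Prop) [DecidablePred P] :
    #{e : G.edgeSet | v ∈ edgeEnds G e ∧ P e.1} = {u | G.Adj v u ∧ P s(v, u)}.ncard := by
  rw [← Set.ncard_coe_finset]
  symm
  refine Set.ncard_congr (fun u hu => ⟨s(v, u), hu.1⟩) ?_ ?_ ?_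
  · intro u hu
    simpa [mem_edgeEnds] using hu.2
  · intro u w hu hw huw
    exact Sym2.congr_right.1 (congrArg Subtype.val huw)
  · rintro ⟨e, he⟩ hP
    simp only [coe_filter, mem_univ, true_and, Set.mem_ofPred_eq, mem_edgeEnds] at hP
    obtain ⟨⟨u, rfl⟩, hP⟩ := hP
    exact ⟨u, ⟨he, hP⟩, rfl⟩

lemma nearlyRegular {φ : Sym2 V → ℕ} {r ε : ℝ}
    (hdeg : ∀ v, |((G.neighborSet v).ncard : ℝ) - r| ≤ ε * r)
    (hg : Paper.GBounded G φ ((1 + ε) * r)) (hl : Paper.LBounded G φ (ε * r)) :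
    NearlyRegular (edgeEnds G) (edgeColour G φ) r ε where
  card_ends e := Sym2.card_toFinset_of_not_isDiag _ (G.not_isDiag_of_mem_edgeSet e.2)
  deg v := by
    have := card_incident (G := G) v fun _ => True
    simp only [and_true] at this
    rw [this]
    exact hdeg v
  colour c := by
    refine le_of_eq_of_le ?_ (hg c)
    rw [← Set.ncard_coe_finset, ← Set.ncard_image_of_injective _ Subtype.val_injective]
    congr 2
    ext e
    simp [Paper.colourCls, edgeColour, Subtype.ext_iff, and_comm]
  locally_bounded v c := by
    have := card_incident (G := G) v fun e => φ e = c
    refine le_of_eq_of_le ?_ (hl v c)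
    rw [← this]
    simp [edgeColour, Subtype.ext_iff]
  simple u v huv := by
    refine card_le_one.2 fun e he f hf => ?_
    simp only [mem_filter, mem_univ, true_and, mem_edgeEnds] at he hf
    exact Subtype.ext (((Sym2.mem_and_mem_iff huv).1 he).trans
      ((Sym2.mem_and_mem_iff huv).1 hf).symm)

end Instantiate

/-- Approximate decompositions into rainbow matchings, with the number of vertices being
arbitrary. -/
theorem exists_apxDecomp {δ : ℝ} (hδ : 0 < δ) :
    ∃ ε : ℝ, 0 < ε ∧ ∀ {V : Type} [Fintype V] [Nonempty V] (G : SimpleGraph V) (r : ℝ),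
      ε⁻¹ ≤ r → (∀ v, |((G.neighborSet v).ncard : ℝ) - r| ≤ ε * r) →
      ∀ φ : Sym2 V → ℕ,
      Paper.GBounded G φ ((1 + ε) * r) → Paper.LBounded G φ (ε * r) →
      ∃ (t : ℕ) (L : Fin t → G.Subgraph), Paper.ApxDecomp G (2 * δ) L ∧
        ∀ i, (L i).IsMatching ∧ Paper.Rainbow φ (L i).edgeSet ∧
          (1 - δ) * Fintype.card V ≤ ((L i).verts.ncard : ℝ) := by
  classical
  obtain ⟨ε, hε, h⟩ := exists_good_blocks hδ
  refine ⟨ε, hε, ?_⟩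
  intro V _ _ G r hr hdeg φ hg hl
  obtain ⟨t, M, I, hM, hI, hcard⟩ :=
    h (edgeEnds G) (edgeColour G φ) r ((inv_le_iff_one_le_mul₀' hε).1 hr)
      (nearlyRegular hdeg hg hl)
  have inj : ∀ a ∈ M, ∀ b ∈ M, ∀ x, x ∈ block (edgeEnds G) a.1 a.2 (edgeColour G φ a.1) a.2 →
      x ∈ block (edgeEnds G) b.1 b.2 (edgeColour G φ b.1) b.2 → a = b := by
    intro a ha b hb x hxa hxb
    by_contra hab
    exact disjoint_left.1 (hM a ha b hb hab) hxa hxb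
  set S : Fin t → Set (Sym2 V) := fun i => {e | ∃ he : e ∈ G.edgeSet, (⟨e, he⟩, i) ∈ M}
  have hSG : ∀ i, S i ⊆ G.edgeSet := fun i e he => he.1
  refine ⟨#I, fun k => ofEdges (S (I.equivFin.symm k)) (hSG _), ⟨?_, ?_⟩, fun k => ?_⟩
  · intro k l hkl
    simp only [edgeSet_ofEdges]
    refine Set.disjoint_left.2 ?_
    rintro e ⟨he, hk⟩ ⟨_, hl⟩
    have := inj _ hk _ hl (.inr (.inl ⟨e, he⟩)) (edge_mem_block.2 rfl) (edge_mem_block.2 rfl)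
    exact hkl (I.equivFin.symm.injective (Subtype.ext (congrArg Prod.snd this)))
  · simp only [edgeSet_ofEdges]
    have hU : ⋃ k, S (I.equivFin.symm k) =
        ↑((M.filter fun a => a.2 ∈ I).image fun a => a.1.1) := by
      ext e
      simp only [Set.mem_iUnion, coe_image, coe_filter, Set.mem_image, Set.mem_ofPred_eq]
      constructor
      · rintro ⟨k, he, hk⟩
        exact ⟨_, ⟨hk, (I.equivFin.symm k).2⟩, rfl⟩
      · rintro ⟨⟨⟨e, he⟩, i⟩, ⟨hm, hi⟩, rfl⟩
        exact ⟨I.equivFin ⟨i, hi⟩, he, by simpa using hm⟩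
    have hcardU : #((M.filter fun a => a.2 ∈ I).image fun a => a.1.1) = #{a ∈ M | a.2 ∈ I} := by
      refine card_image_of_injOn ?_
      intro a ha b hb hab
      have hab' : a.1 = b.1 := Subtype.ext hab
      exact inj a (mem_filter.1 ha).1 b (mem_filter.1 hb).1 (.inr (.inl a.1))
        (edge_mem_block.2 rfl) (edge_mem_block.2 hab')
    have hsub : (↑((M.filter fun a => a.2 ∈ I).image fun a => a.1.1) : Set (Sym2 V)) ⊆
        G.edgeSet := by
      rw [← hU]
      exact Set.iUnion_subset fun k => hSG _
    have hE : G.edgeSet.ncard = Fintype.card G.edgeSet := (Set.fintypeCard_eq_ncard _).symm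
    have hsum := Set.ncard_sdiff_add_ncard_of_subset hsub (Set.toFinite _)
    rw [Set.ncard_coe_finset, hcardU, hE] at hsum
    rw [hU, hE]
    refine le_trans (le_of_eq ?_) hcard
    rw [← hsum]
    push_cast
    ring
  · have hi := hI _ (I.equivFin.symm k).2
    set i : Fin t := (I.equivFin.symm k : Fin t)
    refine ⟨isMatching_ofEdges ?_, ?_, ?_⟩
    · rintro e ⟨he, hme⟩ f ⟨hf, hmf⟩ v hve hvf
      have := inj _ hme _ hmf (.inl (v, i)) (vertex_mem_block.2 ⟨mem_edgeEnds.2 hve, rfl⟩)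
        (vertex_mem_block.2 ⟨mem_edgeEnds.2 hvf, rfl⟩)
      exact congrArg (fun a => a.1.1) this
    · rw [edgeSet_ofEdges]
      rintro e ⟨he, hme⟩ f ⟨hf, hmf⟩ hef
      have := inj _ hme _ hmf (.inr (.inr (edgeColour G φ ⟨e, he⟩, i)))
        (colour_mem_block.2 ⟨rfl, rfl⟩) (colour_mem_block.2 ⟨Subtype.ext hef, rfl⟩)
      exact congrArg (fun a => a.1.1) this
    · have hc : (univ.filter fun v => ∀ a ∈ M, ¬ (v ∈ edgeEnds G a.1 ∧ i = a.2) : Set V) =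
          (ofEdges (S i) (hSG i)).vertsᶜ := by
        ext v
        simp only [coe_filter, mem_univ, true_and, Set.mem_ofPred_eq, Set.mem_compl_iff]
        constructor
        · rintro hv ⟨e, ⟨he, hme⟩, hve⟩
          exact hv _ hme ⟨mem_edgeEnds.2 hve, rfl⟩
        · rintro hv ⟨⟨e, he⟩, j⟩ ha ⟨hve, rfl⟩
          exact hv ⟨e, ⟨he, ha⟩, mem_edgeEnds.1 hve⟩
      have h1 := Set.ncard_add_ncard_compl (ofEdges (S i) (hSG i)).verts
      rw [← hc, Set.ncard_coe_finset, Nat.card_eq_fintype_card] at h1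
      have h2 : ((ofEdges (S i) (hSG i)).verts.ncard : ℝ) +
          #{v | ∀ a ∈ M, ¬ (v ∈ edgeEnds G a.1 ∧ i = a.2)} = Fintype.card V := by
        exact_mod_cast h1
      linarith

end RandomRemoval

/-- Theorem 5.2: approximate decomposition of an almost-regular graph with a suitably
bounded colouring into almost-spanning rainbow matchings. -/
theorem stmt_17 :
    ∀ δ : ℝ, 0 < δ →
    ∃ ε : ℝ, 0 < ε ∧ ∃ n₀ : ℕ, ∀ n : ℕ, n₀ ≤ n → ∀ rr : ℝ, ε⁻¹ ≤ rr →
    ∀ G : SimpleGraph (Fin n),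
      (∀ v, |((G.neighborSet v).ncard : ℝ) - rr| ≤ ε * rr) →
    ∀ φ : Sym2 (Fin n) → ℕ,
      GBounded G φ ((1 + ε) * rr) → LBounded G φ (ε * rr) →
      ∃ (t : ℕ) (L : Fin t → G.Subgraph),
        ApxDecomp G (2 * δ) L ∧
        ∀ i, (L i).IsMatching ∧ Rainbow φ (L i).edgeSet ∧
          (1 - δ) * n ≤ ((L i).verts.ncard : ℝ) := by
  intro δ hδ
  obtain ⟨ε, hε, h⟩ := RandomRemoval.exists_apxDecomp hδ
  refine ⟨ε, hε, 1, fun n hn r hr G hdeg φ hg hl => ?_⟩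
  have : Nonempty (Fin n) := ⟨⟨0, hn⟩⟩
  simpa only [Fintype.card_fin] using h G r hr hdeg φ hg hl
end

section
/- For all f, C ∈ ℕ there exists ε₀ > 0; for every 0 < ε ≤ ε₀ there exists ζ₀ > 0; for every 0 < ζ ≤ ζ₀ there exists n₀ ∈ ℕ such that the following holds for all n ≥ n₀. Let F be an f-vertex graph, let G be an n-vertex graph, and let φ be an edge-colouring of G that is Cn-bounded and locally ζn-bounded. Fix a vertex u of G and an edge vw of G, and suppose that either vw is not an edge of Ir^φ_G(ζn) or F is triangle-free. Then the number of non-rainbow copies of F in G containing u is at most ε·n^{f−1}, and the number of non-rainbow copies of F in G containing the edge vw is at most ε·n^{f−2}. -/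
open Paper

namespace Paper

lemma ncard_iUnion_le_card_mul {ι α : Type*} [Fintype ι] [Finite α] (s : ι → Set α) (r : ℝ)
    (h : ∀ i, ((s i).ncard : ℝ) ≤ r) : ((⋃ i, s i).ncard : ℝ) ≤ Fintype.card ι * r := by
  have h1 : ((⋃ i, s i).ncard : ℝ) ≤ ∑ i, ((s i).ncard : ℝ) := by
    exact_mod_cast Set.ncard_iUnion_le_of_fintype s
  refine h1.trans ((Finset.sum_le_sum fun i _ => h i).trans ?_)
  simp

/-- A set of functions agreeing on `D`, in which a single coordinate outside `D` has at most
`r |V|` values once the others are chosen, has at most `r |V| ^ (|W| - |D|)` members. -/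
lemma ncard_le_of_update {V W : Type*} [Fintype V] [Fintype W] [DecidableEq W]
    (D : Finset W) (d : W) (hd : d ∉ D) (A : Set (W → V)) {r : ℝ} (h0 : 0 ≤ r)
    (hD : ∀ ψ ∈ A, ∀ χ ∈ A, ∀ i ∈ D, ψ i = χ i)
    (hr : ∀ ψ ∈ A, ({t | Function.update ψ d t ∈ A}.ncard : ℝ) ≤ r * Fintype.card V) :
    (A.ncard : ℝ) ≤ r * (Fintype.card V : ℝ) ^ (Fintype.card W - D.card) := by
  classical
  let R : Finset W := (insert d D)ᶜ
  let ρ : (W → V) → (R → V) := fun ψ i => ψ i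
  have hR : R.card + 1 = Fintype.card W - D.card := by
    have h1 := Finset.card_insert_of_notMem hd
    have h2 := Finset.card_add_card_compl (insert d D)
    change (insert d D)ᶜ.card + 1 = _
    omega
  have key : A.toFinset.card ≤
      ⌊r * Fintype.card V⌋₊ * (Finset.univ : Finset (R → V)).card := by
    refine Finset.card_le_mul_card_image_of_maps_to (f := ρ) (fun _ _ => Finset.mem_univ _) _ ?_
    intro σ _
    rcases (A.toFinset.filter fun ψ => ρ ψ = σ).eq_empty_or_nonempty with h | ⟨ψ, hψ⟩
    · simp [h]
    simp only [Finset.mem_filter, Set.mem_toFinset] at hψ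
    refine le_trans ?_ (Nat.le_floor (hr ψ hψ.1))
    rw [← Set.ncard_coe_finset]
    have hupd : ∀ χ ∈ A, ρ χ = σ → Function.update ψ d (χ d) = χ := by
      intro χ hχ hσ
      funext i
      by_cases hi : i = d
      · subst hi; simp
      rw [Function.update_of_ne hi]
      by_cases hiD : i ∈ D
      · exact hD _ hψ.1 _ hχ i hiD
      · exact congrFun (hψ.2.trans hσ.symm) ⟨i, by simp [R, hi, hiD]⟩
    refine Set.ncard_le_ncard_of_injOn (fun χ => χ d) ?_ ?_ (Set.toFinite _)
    · intro χ hχ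
      simp only [Finset.coe_filter, Set.mem_toFinset, Set.mem_ofPred_eq] at hχ
      simpa [hupd χ hχ.1 hχ.2] using hχ.1
    · intro χ hχ χ' hχ' he
      simp only [Finset.coe_filter, Set.mem_toFinset, Set.mem_ofPred_eq] at hχ hχ'
      rw [← hupd χ hχ.1 hχ.2, ← hupd χ' hχ'.1 hχ'.2]
      exact congrArg _ he
  have hnn : 0 ≤ r * Fintype.card V := by positivity
  have hc : (Finset.univ : Finset (R → V)).card = Fintype.card V ^ R.card := by simp
  rw [hc] at key
  rw [Set.ncard_eq_toFinset_card', ← hR, pow_succ]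
  calc (A.toFinset.card : ℝ) ≤ ⌊r * Fintype.card V⌋₊ * (Fintype.card V : ℝ) ^ R.card := by
        exact_mod_cast key
    _ ≤ (r * Fintype.card V) * (Fintype.card V : ℝ) ^ R.card := by
        gcongr
        exact Nat.floor_le hnn
    _ = _ := by ring

/-- The functions in `K` that send some pair `c, d` with `d ∉ D` to an edge having the colour of
the image of a pair `a, b` avoiding `d`. -/
def freeCollisions {V W C : Type*} (G : SimpleGraph V) (φ : Sym2 V → C)
    (D : Finset W) (K : Set (W → V)) : Set (W → V) :=
  {ψ | ψ ∈ K ∧ ∃ a b c d, d ∉ D ∧ d ≠ a ∧ d ≠ b ∧ d ≠ c ∧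
    G.Adj (ψ c) (ψ d) ∧ φ s(ψ c, ψ d) = φ s(ψ a, ψ b)}

lemma ncard_freeCollisions_le {V W C : Type*} [Fintype V] [Fintype W]
    {G : SimpleGraph V} {φ : Sym2 V → C} {r : ℝ} (hr : 0 ≤ r)
    (hφ : LBounded G φ (r * Fintype.card V)) (D : Finset W) (K : Set (W → V))
    (hK : ∀ ψ ∈ K, ∀ χ ∈ K, ∀ i ∈ D, ψ i = χ i) :
    ((freeCollisions G φ D K).ncard : ℝ) ≤
      (Fintype.card W : ℝ) ^ 4 * (r * (Fintype.card V : ℝ) ^ (Fintype.card W - D.card)) := by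
  classical
  let A : W × W × W × W → Set (W → V) := fun q =>
    {ψ | ψ ∈ K ∧ q.2.2.2 ∉ D ∧ q.2.2.2 ≠ q.1 ∧ q.2.2.2 ≠ q.2.1 ∧ q.2.2.2 ≠ q.2.2.1 ∧
      G.Adj (ψ q.2.2.1) (ψ q.2.2.2) ∧ φ s(ψ q.2.2.1, ψ q.2.2.2) = φ s(ψ q.1, ψ q.2.1)}
  have hsub : freeCollisions G φ D K ⊆ ⋃ q, A q := by
    rintro ψ ⟨hψ, a, b, c, d, h⟩
    exact Set.mem_iUnion.2 ⟨(a, b, c, d), hψ, h⟩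
  have hA : ∀ q, ((A q).ncard : ℝ) ≤
      r * (Fintype.card V : ℝ) ^ (Fintype.card W - D.card) := by
    rintro ⟨a, b, c, d⟩
    by_cases hd : d ∉ D ∧ d ≠ a ∧ d ≠ b ∧ d ≠ c
    · obtain ⟨hdD, hda, hdb, hdc⟩ := hd
      refine ncard_le_of_update D d hdD _ hr (fun ψ hψ χ hχ => hK ψ hψ.1 χ hχ.1) fun ψ _ => ?_
      refine le_trans ?_ (hφ (ψ c) (φ s(ψ a, ψ b)))
      refine Nat.cast_le.2 (Set.ncard_le_ncard ?_ (Set.toFinite _))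
      rintro t ⟨-, -, -, -, -, hadj, hcol⟩
      simp only [Function.update_self, Function.update_of_ne hda.symm,
        Function.update_of_ne hdb.symm, Function.update_of_ne hdc.symm] at hadj hcol
      exact ⟨hadj, hcol⟩
    · have : A (a, b, c, d) = ∅ := by
        ext ψ
        simp only [A, Set.mem_ofPred_eq, Set.mem_empty_iff_false, iff_false]
        tauto
      rw [this]
      simp only [Set.ncard_empty, Nat.cast_zero]
      positivity
  refine le_trans (Nat.cast_le.2 (Set.ncard_le_ncard hsub (Set.toFinite _))) ?_
  refine (ncard_iUnion_le_card_mul A _ hA).trans (le_of_eq ?_)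
  simp only [Fintype.card_prod]
  push_cast
  ring

/-- The functions sending `x, y` to `v, w` and some further element to a common neighbour of
`v` and `w` that sees them in the same colour. -/
def apexCollisions {V W C : Type*} (G : SimpleGraph V) (φ : Sym2 V → C)
    (x y : W) (v w : V) : Set (W → V) :=
  {ψ | ψ x = v ∧ ψ y = w ∧ ∃ a, a ≠ x ∧ a ≠ y ∧ ψ a ∈ monoSet G φ v w}

lemma ncard_apexCollisions_le {V W C : Type*} [Fintype V] [Fintype W] [DecidableEq W]
    {G : SimpleGraph V} {φ : Sym2 V → C} {r : ℝ} (hr : 0 ≤ r) {v w : V}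
    (h : (monoCodeg G φ v w : ℝ) ≤ r * Fintype.card V) (x y : W) :
    ((apexCollisions G φ x y v w).ncard : ℝ) ≤ Fintype.card W *
      (r * (Fintype.card V : ℝ) ^ (Fintype.card W - ({x, y} : Finset W).card)) := by
  let A : W → Set (W → V) := fun a =>
    {ψ | ψ x = v ∧ ψ y = w ∧ a ≠ x ∧ a ≠ y ∧ ψ a ∈ monoSet G φ v w}
  have hsub : apexCollisions G φ x y v w ⊆ ⋃ a, A a := by
    rintro ψ ⟨hx, hy, a, ha⟩
    exact Set.mem_iUnion.2 ⟨a, hx, hy, ha⟩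
  refine le_trans (Nat.cast_le.2 (Set.ncard_le_ncard hsub (Set.toFinite _))) ?_
  refine ncard_iUnion_le_card_mul A _ fun a => ?_
  by_cases ha : a ≠ x ∧ a ≠ y
  · refine ncard_le_of_update _ a (by simpa using ha) _ hr ?_ fun ψ _ => ?_
    · rintro ψ ⟨hx, hy, -⟩ χ ⟨hx', hy', -⟩ i hi
      simp only [Finset.mem_insert, Finset.mem_singleton] at hi
      rcases hi with rfl | rfl
      · rw [hx, hx']
      · rw [hy, hy']
    · refine le_trans ?_ h
      refine Nat.cast_le.2 (Set.ncard_le_ncard ?_ (Set.toFinite _))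
      rintro t ⟨-, -, -, -, ht⟩
      simpa using ht
  · have : A a = ∅ := by
      ext ψ
      simp only [A, Set.mem_ofPred_eq, Set.mem_empty_iff_false, iff_false]
      tauto
    rw [this]
    simp only [Set.ncard_empty, Nat.cast_zero]
    positivity

/-- `ψ` is an isomorphism from `F` onto the subgraph `H`. -/
def Parametrizes {V W : Type*} (F : SimpleGraph W) {G : SimpleGraph V} (H : G.Subgraph)
    (ψ : W → V) : Prop :=
  Function.Injective ψ ∧ Set.range ψ = H.verts ∧
    ∀ p q, H.Adj p q ↔ ∃ a b, F.Adj a b ∧ ψ a = p ∧ ψ b = q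

lemma IsCopy.exists_parametrizes {V W : Type*} {F : SimpleGraph W} {G : SimpleGraph V}
    {H : G.Subgraph} (h : IsCopy F H) : ∃ ψ, Parametrizes F H ψ := by
  obtain ⟨e⟩ := h
  refine ⟨fun a => e a, fun a b hab => e.injective (Subtype.ext hab), ?_, fun p q => ⟨?_, ?_⟩⟩
  · ext p
    constructor
    · rintro ⟨a, rfl⟩
      exact (e a).2
    · intro hp
      exact ⟨e.symm ⟨p, hp⟩, by simp⟩
  · intro hpq
    refine ⟨e.symm ⟨p, hpq.fst_mem⟩, e.symm ⟨q, hpq.snd_mem⟩, ?_, by simp, by simp⟩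
    rw [e.symm.map_adj_iff]
    exact hpq
  · rintro ⟨a, b, hab, rfl, rfl⟩
    exact e.map_adj_iff.2 hab

lemma ncard_le_of_parametrizes {V W : Type*} [Finite V] [Finite W] {F : SimpleGraph W}
    {G : SimpleGraph V} (S : Set G.Subgraph) (B : Set (W → V))
    (h : ∀ H ∈ S, ∃ ψ ∈ B, Parametrizes F H ψ) : S.ncard ≤ B.ncard := by
  rcases isEmpty_or_nonempty (W → V) with hE | hE
  · have : S = ∅ := by
      ext H
      exact ⟨fun hH => hE.elim (h H hH).choose, False.elim⟩
    simp [this]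
  choose! ψ hB hψ using h
  refine Set.ncard_le_ncard_of_injOn ψ hB ?_ (Set.toFinite _)
  intro H hH H' hH' he
  have h1 := hψ H hH
  have h2 := hψ H' hH'
  rw [← he] at h2
  refine SimpleGraph.Subgraph.ext (h1.2.1.symm.trans h2.2.1) ?_
  funext p q
  exact propext ((h1.2.2 p q).trans (h2.2.2 p q).symm)

lemma Parametrizes.exists_of_not_rainbow {V W C : Type*} {F : SimpleGraph W}
    {G : SimpleGraph V} {φ : Sym2 V → C} {H : G.Subgraph} {ψ : W → V}
    (h : Parametrizes F H ψ) (hR : ¬ Rainbow φ H.edgeSet) :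
    ∃ a b c d, F.Adj a b ∧ F.Adj c d ∧ s(a, b) ≠ s(c, d) ∧
      φ s(ψ a, ψ b) = φ s(ψ c, ψ d) := by
  simp only [Rainbow, Set.InjOn, not_forall] at hR
  obtain ⟨e, he, e', he', hφ, hne⟩ := hR
  induction e using Sym2.ind with | _ p q =>
  induction e' using Sym2.ind with | _ p' q' =>
  rw [SimpleGraph.Subgraph.mem_edgeSet] at he he'
  obtain ⟨a, b, hab, rfl, rfl⟩ := (h.2.2 _ _).1 he
  obtain ⟨c, d, hcd, rfl, rfl⟩ := (h.2.2 _ _).1 he'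
  refine ⟨a, b, c, d, hab, hcd, fun hs => hne ?_, hφ⟩
  simpa using congrArg (Sym2.map ψ) hs

lemma Parametrizes.adj {V W : Type*} {F : SimpleGraph W}
    {G : SimpleGraph V} {H : G.Subgraph} {ψ : W → V}
    (h : Parametrizes F H ψ) {a b : W} (hab : F.Adj a b) : G.Adj (ψ a) (ψ b) :=
  ((h.2.2 _ _).2 ⟨a, b, hab, rfl, rfl⟩).adj_sub

/-- A non-rainbow copy either has two edges of the same colour one of which has an endpoint
outside `D` and the other edge, or the symmetric difference of two such edges lies in `D`. -/
lemma Parametrizes.mem_freeCollisions_or {V W C : Type*} {F : SimpleGraph W}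
    {G : SimpleGraph V} {φ : Sym2 V → C} {H : G.Subgraph} {ψ : W → V}
    (h : Parametrizes F H ψ) (hR : ¬ Rainbow φ H.edgeSet) (D : Finset W) (K : Set (W → V))
    (hK : ψ ∈ K) :
    ψ ∈ freeCollisions G φ D K ∨ ∃ a b c d, F.Adj a b ∧ F.Adj c d ∧ s(a, b) ≠ s(c, d) ∧
      φ s(ψ a, ψ b) = φ s(ψ c, ψ d) ∧ (a ∈ D ∨ a = c ∨ a = d) ∧ (b ∈ D ∨ b = c ∨ b = d) ∧
      (c ∈ D ∨ c = a ∨ c = b) ∧ (d ∈ D ∨ d = a ∨ d = b) := by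
  obtain ⟨a, b, c, d, hab, hcd, hne, hφ⟩ := h.exists_of_not_rainbow hR
  refine or_iff_not_imp_left.2 fun hA => ?_
  have key : ∀ a b c d, F.Adj c d → φ s(ψ c, ψ d) = φ s(ψ a, ψ b) → d ∈ D ∨ d = a ∨ d = b := by
    intro a b c d hcd hφ
    by_contra! hd
    exact hA ⟨hK, a, b, c, d, hd.1, hd.2.1, hd.2.2, hcd.ne', h.adj hcd, hφ⟩
  refine ⟨a, b, c, d, hab, hcd, hne, hφ, ?_, ?_, ?_, ?_⟩
  · exact key c d b a hab.symm (by rw [Sym2.eq_swap, hφ])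
  · exact key c d a b hab hφ
  · exact key a b d c hcd.symm (by rw [Sym2.eq_swap, hφ])
  · exact key a b c d hcd hφ.symm

lemma Parametrizes.mem_freeCollisions_singleton {V W C : Type*} {F : SimpleGraph W}
    {G : SimpleGraph V} {φ : Sym2 V → C} {H : G.Subgraph} {ψ : W → V}
    (h : Parametrizes F H ψ) (hR : ¬ Rainbow φ H.edgeSet) (x : W) (K : Set (W → V))
    (hK : ψ ∈ K) : ψ ∈ freeCollisions G φ {x} K := by
  rcases h.mem_freeCollisions_or hR {x} K hK with h' | ⟨a, b, c, d, hab, hcd, hne, -, h⟩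
  · exact h'
  · have h1 := hab.ne
    have h2 := hcd.ne
    simp only [Finset.mem_singleton, ne_eq, Sym2.eq_iff] at h hne
    grind

lemma Parametrizes.mem_freeCollisions_or_mem_monoSet {V W C : Type*} [DecidableEq W]
    {F : SimpleGraph W} {G : SimpleGraph V} {φ : Sym2 V → C} {H : G.Subgraph} {ψ : W → V}
    (h : Parametrizes F H ψ) (hR : ¬ Rainbow φ H.edgeSet) (x y : W) (K : Set (W → V))
    (hK : ψ ∈ K) : ψ ∈ freeCollisions G φ {x, y} K ∨
      ∃ a, F.Adj x a ∧ F.Adj y a ∧ ψ a ∈ monoSet G φ (ψ x) (ψ y) := by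
  rcases h.mem_freeCollisions_or hR {x, y} K hK with
    h' | ⟨a, b, c, d, hab, hcd, hne, hφ, hd⟩
  · exact Or.inl h'
  · right
    suffices hs : ∃ a, F.Adj x a ∧ F.Adj y a ∧ φ s(ψ x, ψ a) = φ s(ψ y, ψ a) by
      obtain ⟨a, hx, hy, hc⟩ := hs
      exact ⟨a, hx, hy, h.adj hx, h.adj hy, hc⟩
    have h1 := hab.ne
    have h2 := hcd.ne
    have h3 := hab.symm
    have h4 := hcd.symm
    have s1 := Sym2.eq_swap (a := ψ a) (b := ψ b)
    have s2 := Sym2.eq_swap (a := ψ c) (b := ψ d)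
    simp only [Finset.mem_insert, Finset.mem_singleton, ne_eq, Sym2.eq_iff] at hd hne
    grind

lemma ncard_nonrainbow_vertex_le {V W C : Type*} [Fintype V] [Fintype W] (F : SimpleGraph W)
    {G : SimpleGraph V} {φ : Sym2 V → C} {r : ℝ} (hr : 0 ≤ r)
    (hφ : LBounded G φ (r * Fintype.card V)) (u : V) :
    (({H : G.Subgraph | IsCopy F H ∧ ¬ Rainbow φ H.edgeSet ∧ u ∈ H.verts}).ncard : ℝ) ≤
      (Fintype.card W : ℝ) ^ 5 * r * (Fintype.card V : ℝ) ^ (Fintype.card W - 1) := by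
  let B : W → Set (W → V) := fun x => freeCollisions G φ {x} {ψ | ψ x = u}
  refine le_trans (Nat.cast_le.2 (ncard_le_of_parametrizes (F := F) _ (⋃ x, B x) ?_)) ?_
  · rintro H ⟨hc, hR, hu⟩
    obtain ⟨ψ, hψ⟩ := hc.exists_parametrizes
    rw [← hψ.2.1] at hu
    obtain ⟨x, hx⟩ := hu
    exact ⟨ψ, Set.mem_iUnion.2 ⟨x, hψ.mem_freeCollisions_singleton hR x _ hx⟩, hψ⟩
  · have hB : ∀ x, ((B x).ncard : ℝ) ≤ (Fintype.card W : ℝ) ^ 4 *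
        (r * (Fintype.card V : ℝ) ^ (Fintype.card W - 1)) := by
      intro x
      have h := ncard_freeCollisions_le hr hφ {x} {ψ | ψ x = u} (by
        intro ψ hψ χ hχ i hi
        rw [Finset.mem_singleton] at hi
        subst hi
        exact Eq.trans hψ (Eq.symm hχ))
      rwa [Finset.card_singleton] at h
    refine (ncard_iUnion_le_card_mul B _ hB).trans (le_of_eq ?_)
    ring

lemma ncard_nonrainbow_edge_le {V W C : Type*} [Fintype V] [Fintype W] (F : SimpleGraph W)
    {G : SimpleGraph V} {φ : Sym2 V → C} {r : ℝ} (hr : 0 ≤ r)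
    (hφ : LBounded G φ (r * Fintype.card V)) (v w : V)
    (hvw : (monoCodeg G φ v w : ℝ) ≤ r * Fintype.card V ∨ F.CliqueFree 3) :
    (({H : G.Subgraph | IsCopy F H ∧ ¬ Rainbow φ H.edgeSet ∧ s(v, w) ∈ H.edgeSet}).ncard : ℝ) ≤
      ((Fintype.card W : ℝ) ^ 6 + (Fintype.card W : ℝ) ^ 3) * r *
        (Fintype.card V : ℝ) ^ (Fintype.card W - 2) := by
  classical
  let B : W × W → Set (W → V) := fun p => {ψ | p.1 ≠ p.2 ∧
    (ψ ∈ freeCollisions G φ {p.1, p.2} {ψ | ψ p.1 = v ∧ ψ p.2 = w} ∨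
      (¬ F.CliqueFree 3 ∧ ψ ∈ apexCollisions G φ p.1 p.2 v w))}
  refine le_trans (Nat.cast_le.2 (ncard_le_of_parametrizes (F := F) _ (⋃ p, B p) ?_)) ?_
  · rintro H ⟨hc, hR, hu⟩
    obtain ⟨ψ, hψ⟩ := hc.exists_parametrizes
    rw [SimpleGraph.Subgraph.mem_edgeSet] at hu
    obtain ⟨x, y, hxy, hx, hy⟩ := (hψ.2.2 _ _).1 hu
    refine ⟨ψ, Set.mem_iUnion.2 ⟨(x, y), hxy.ne, ?_⟩, hψ⟩
    refine (hψ.mem_freeCollisions_or_mem_monoSet hR x y {ψ | ψ x = v ∧ ψ y = w}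
      ⟨hx, hy⟩).imp_right ?_
    rintro ⟨a, hxa, hya, ha⟩
    refine ⟨fun hF => hF {x, y, a} ?_, hx, hy, a, hxa.ne', hya.ne', hx ▸ hy ▸ ha⟩
    exact SimpleGraph.is3Clique_triple_iff.2 ⟨hxy, hxa, hya⟩
  · have hpow : 0 ≤ r * (Fintype.card V : ℝ) ^ (Fintype.card W - 2) := by positivity
    refine (ncard_iUnion_le_card_mul B (((Fintype.card W : ℝ) ^ 4 + Fintype.card W) *
      (r * (Fintype.card V : ℝ) ^ (Fintype.card W - 2))) ?_).trans (le_of_eq ?_)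
    · rintro ⟨x, y⟩
      by_cases hxy : x = y
      · have : B (x, y) = ∅ := by
          ext ψ
          simp [B, hxy]
        rw [this]
        simp only [Set.ncard_empty, Nat.cast_zero]
        positivity
      have hcard : ({x, y} : Finset W).card = 2 := Finset.card_pair hxy
      have hfree := ncard_freeCollisions_le hr hφ {x, y} {ψ | ψ x = v ∧ ψ y = w} (by
        rintro ψ ⟨hx, hy⟩ χ ⟨hx', hy'⟩ i hi
        simp only [Finset.mem_insert, Finset.mem_singleton] at hi
        rcases hi with rfl | rfl
        · rw [hx, hx']
        · rw [hy, hy'])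
      rw [hcard] at hfree
      have hapex : ({ψ | ¬ F.CliqueFree 3 ∧ ψ ∈ apexCollisions G φ x y v w}.ncard : ℝ) ≤
          Fintype.card W * (r * (Fintype.card V : ℝ) ^ (Fintype.card W - 2)) := by
        by_cases hF : F.CliqueFree 3
        · simp only [hF, not_true_eq_false, false_and, Set.ofPred_false, Set.ncard_empty,
            Nat.cast_zero]
          positivity
        · have := ncard_apexCollisions_le hr (hvw.resolve_right hF) x y
          rw [hcard] at this
          simpa [hF] using this
      have hun : (B (x, y)).ncard ≤ _ := (Set.ncard_le_ncard (fun ψ hψ => hψ.2)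
        (Set.toFinite _)).trans (Set.ncard_union_le _ _)
      have hun' := (Nat.cast_le (α := ℝ)).2 hun
      push_cast at hun'
      rw [add_mul]
      exact hun'.trans (add_le_add hfree hapex)
    · simp only [Fintype.card_prod]
      push_cast
      ring

end Paper

/-- Lemma A.2 (non-rainbow counting lemma): there are few non-rainbow copies of `F`
through a given vertex or a given (well-behaved) edge. -/
theorem stmt_18 :
    ∀ f Cb : ℕ,
    ∃ ε₀ : ℝ, 0 < ε₀ ∧ ∀ ε : ℝ, 0 < ε → ε ≤ ε₀ →
    ∃ ζ₀ : ℝ, 0 < ζ₀ ∧ ∀ ζ : ℝ, 0 < ζ → ζ ≤ ζ₀ →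
    ∃ n₀ : ℕ, ∀ n : ℕ, n₀ ≤ n →
    ∀ (F : SimpleGraph (Fin f)) (G : SimpleGraph (Fin n)) (φ : Sym2 (Fin n) → ℕ),
      GBounded G φ ((Cb : ℝ) * n) → LBounded G φ (ζ * n) →
    ∀ (u v w : Fin n), G.Adj v w →
      ((monoCodeg G φ v w : ℝ) < ζ * n ∨ F.CliqueFree 3) →
      ((({H : G.Subgraph | IsCopy F H ∧ ¬ Rainbow φ H.edgeSet ∧
            u ∈ H.verts}).ncard : ℝ) ≤ ε * (n : ℝ) ^ (f - 1)) ∧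
      ((({H : G.Subgraph | IsCopy F H ∧ ¬ Rainbow φ H.edgeSet ∧
            s(v, w) ∈ H.edgeSet}).ncard : ℝ) ≤ ε * (n : ℝ) ^ (f - 2)) := by
  intro f Cb
  refine ⟨1, one_pos, fun ε hε _ => ?_⟩
  set M : ℝ := (f : ℝ) ^ 6 + (f : ℝ) ^ 5 + (f : ℝ) ^ 3 + 1 with hM
  have hMpos : 0 < M := by positivity
  refine ⟨ε / M, by positivity, fun ζ hζ hζε => ⟨0, fun n _ F G φ _ hL u v w _ hvw => ?_⟩⟩
  have hζM : M * ζ ≤ ε := by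
    rw [le_div_iff₀ hMpos] at hζε
    linarith
  have h6 : 0 ≤ (f : ℝ) ^ 6 * ζ := by positivity
  have h5 : 0 ≤ (f : ℝ) ^ 5 * ζ := by positivity
  have h3 : 0 ≤ (f : ℝ) ^ 3 * ζ := by positivity
  have hL' : LBounded G φ (ζ * Fintype.card (Fin n)) := by simpa using hL
  constructor
  · refine (ncard_nonrainbow_vertex_le F hζ.le hL' u).trans ?_
    simp only [Fintype.card_fin]
    refine mul_le_mul_of_nonneg_right ?_ (by positivity)
    rw [hM] at hζM
    linarith
  · refine (ncard_nonrainbow_edge_le F hζ.le hL' v w (hvw.imp_left ?_)).trans ?_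
    · intro h
      simpa using h.le
    simp only [Fintype.card_fin]
    refine mul_le_mul_of_nonneg_right ?_ (by positivity)
    rw [hM] at hζM
    linarith
end
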